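/- arXiv:1411.6408 — 6 statements merged into one kernel-verified Lean document; each statement's English description precedes it below -/
import Mathlib

section
/- Let C be a non-redundant sorting network on n channels of depth d. Then every comparator in the last layer L_d of C is of the form (i,i+1), i.e., it connects two adjacent channels. -/
/-- Apply one parallel layer of comparators to a 0/1 vector (Bool: false = 0, true = 1):
each comparator `(i,j)` puts the minimum on channel `i` and the maximum on channel `j`. -/
def applyLayer {n : ℕ} (L : Finset (Fin n × Fin n)) (x : Fin n → Bool) : Fin n → Bool :=
  fun c => (x c && decide (∀ j, (c, j) ∈ L → x j = true)) ||
           decide (∃ i, (i, c) ∈ L ∧ x i = true)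

/-- Apply a comparator network (a list of layers) to a 0/1 vector, layer by layer. -/
def applyNet {n : ℕ} (C : List (Finset (Fin n × Fin n))) (x : Fin n → Bool) : Fin n → Bool :=
  C.foldl (fun v L => applyLayer L v) x

/-- A valid layer: each comparator `(i,j)` has `i < j`, and every channel appears
in at most one comparator of the layer. -/
def ValidLayer {n : ℕ} (L : Finset (Fin n × Fin n)) : Prop :=
  (∀ p ∈ L, p.1 < p.2) ∧
  ∀ p ∈ L, ∀ q ∈ L, p ≠ q → p.1 ≠ q.1 ∧ p.1 ≠ q.2 ∧ p.2 ≠ q.1 ∧ p.2 ≠ q.2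

/-- A valid comparator network: every layer is valid. -/
def ValidNet {n : ℕ} (C : List (Finset (Fin n × Fin n))) : Prop :=
  ∀ L ∈ C, ValidLayer L

/-- A 0/1 vector is sorted in ascending order. -/
def SortedVec {n : ℕ} (x : Fin n → Bool) : Prop :=
  ∀ i j : Fin n, i ≤ j → x i ≤ x j

/-- A sorting network: a valid network sorting every 0/1 input. -/
def SortingNet {n : ℕ} (C : List (Finset (Fin n × Fin n))) : Prop :=
  ValidNet C ∧ ∀ x : Fin n → Bool, SortedVec (applyNet C x)

/-- The comparator `p` placed in the layer of index `k` (0-based) is redundant: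
its top input is already ≤ its bottom input on every output of the prefix
(comparators in the same layer act on disjoint channels, so they do not affect
the inputs of `p`). -/
def Redundant {n : ℕ} (C : List (Finset (Fin n × Fin n))) (k : ℕ) (p : Fin n × Fin n) : Prop :=
  ∀ x : Fin n → Bool, applyNet (C.take k) x p.1 ≤ applyNet (C.take k) x p.2

/-- No comparator of the network is redundant. -/
def NonRedundant {n : ℕ} (C : List (Finset (Fin n × Fin n))) : Prop :=
  ∀ k : ℕ, ∀ p ∈ C.getD k ∅, ¬ Redundant C k p

theorem al_fst {n : ℕ} {L : Finset (Fin n × Fin n)} (hL : ValidLayer L) (x : Fin n → Bool)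
    {i j : Fin n} (h : (i, j) ∈ L) : applyLayer L x i = (x i && x j) := by
  have h1 : ∀ k, (i, k) ∈ L → k = j := by
    intro k hk
    by_contra hne
    exact (hL.2 _ hk _ h (by simp [hne])).1 rfl
  have h2 : ∀ k, (k, i) ∉ L := by
    intro k hk
    by_cases he : (k, i) = (i, j)
    · have := hL.1 _ hk
      simp at he this
      exact absurd he.1 this.ne
    · exact (hL.2 _ hk _ h he).2.2.1 rfl
  have h3 : (∀ k, (i, k) ∈ L → x k = true) ↔ x j = true :=
    ⟨fun H => H j h, fun H k hk => by rw [h1 k hk]; exact H⟩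
  simp [applyLayer, h2, h3]

theorem al_snd {n : ℕ} {L : Finset (Fin n × Fin n)} (hL : ValidLayer L) (x : Fin n → Bool)
    {i j : Fin n} (h : (i, j) ∈ L) : applyLayer L x j = (x i || x j) := by
  have h1 : ∀ k, (k, j) ∈ L → k = i := by
    intro k hk
    by_contra hne
    exact (hL.2 _ hk _ h (by simp [hne])).2.2.2 rfl
  have h2 : ∀ k, (j, k) ∉ L := by
    intro k hk
    by_cases he : (j, k) = (i, j)
    · have := hL.1 _ h
      simp at he this
      exact absurd he.1.symm this.ne
    · exact (hL.2 _ hk _ h he).2.1 rfl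
  have h3 : (∃ k, (k, j) ∈ L ∧ x k = true) ↔ x i = true :=
    ⟨fun ⟨k, hk, H⟩ => by rw [← h1 k hk]; exact H, fun H => ⟨i, h, H⟩⟩
  simp [applyLayer, h2, h3, Bool.or_comm]

theorem al_none {n : ℕ} {L : Finset (Fin n × Fin n)} (x : Fin n → Bool)
    {c : Fin n} (h : ∀ k, (c, k) ∉ L) (h' : ∀ k, (k, c) ∉ L) : applyLayer L x c = x c := by
  simp [applyLayer, h, h']

def StepUp {n : ℕ} (x x' : Fin n → Bool) : Prop :=
  ∃ c, x c = false ∧ x' c = true ∧ ∀ k, k ≠ c → x' k = x k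

theorem step_pair {n : ℕ} {L : Finset (Fin n × Fin n)} (hL : ValidLayer L) {x x' : Fin n → Bool}
    {i j : Fin n} (h : (i, j) ∈ L) (c : Fin n) (hc : c = i ∨ c = j)
    (h0 : x c = false) (h1 : x' c = true) (h2 : ∀ k, k ≠ c → x' k = x k) :
    StepUp (applyLayer L x) (applyLayer L x') := by
  have hij : i ≠ j := (hL.1 _ h).ne
  have hrest : ∀ k, k ≠ i → k ≠ j → applyLayer L x' k = applyLayer L x k := by
    intro k hki hkj
    have hkc : k ≠ c := by rcases hc with rfl | rfl <;> assumption
    by_cases ha : ∃ m, (k, m) ∈ L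
    · obtain ⟨m, hm⟩ := ha
      have hd := hL.2 _ hm _ h (by simp [hki])
      have : m ≠ c := by rcases hc with rfl | rfl; exacts [hd.2.2.1, hd.2.2.2]
      rw [al_fst hL x hm, al_fst hL x' hm, h2 k hkc, h2 m this]
    by_cases hb : ∃ m, (m, k) ∈ L
    · obtain ⟨m, hm⟩ := hb
      have hd := hL.2 _ hm _ h (by simp [hkj])
      have : m ≠ c := by rcases hc with rfl | rfl; exacts [hd.1, hd.2.1]
      rw [al_snd hL x hm, al_snd hL x' hm, h2 k hkc, h2 m this]
    push Not at ha hb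
    rw [al_none x ha hb, al_none x' ha hb, h2 k hkc]
  have e1 := al_fst hL x h
  have e2 := al_snd hL x h
  have e3 := al_fst hL x' h
  have e4 := al_snd hL x' h
  rcases hc with rfl | rfl
  · have hj := h2 j hij.symm
    cases hxj : x j
    · refine ⟨j, by simp [*], by simp [*], fun k hk => ?_⟩
      by_cases hkc : k = c
      · subst hkc; simp [*]
      · exact hrest k hkc hk
    · refine ⟨c, by simp [*], by simp [*], fun k hk => ?_⟩
      by_cases hkc : k = j
      · subst hkc; simp [*]
      · exact hrest k hk hkc
  · have hj := h2 i hij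
    cases hxj : x i
    · refine ⟨c, by simp [*], by simp [*], fun k hk => ?_⟩
      by_cases hkc : k = i
      · subst hkc; simp [*]
      · exact hrest k hkc hk
    · refine ⟨i, by simp [*], by simp [*], fun k hk => ?_⟩
      by_cases hkc : k = c
      · subst hkc; simp [*]
      · exact hrest k hk hkc

theorem step_layer {n : ℕ} {L : Finset (Fin n × Fin n)} (hL : ValidLayer L) {x x' : Fin n → Bool}
    (h : StepUp x x') : StepUp (applyLayer L x) (applyLayer L x') := by
  obtain ⟨c, h0, h1, h2⟩ := h
  by_cases ha : ∃ m, (c, m) ∈ L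
  · obtain ⟨m, hm⟩ := ha
    exact step_pair hL hm c (Or.inl rfl) h0 h1 h2
  by_cases hb : ∃ m, (m, c) ∈ L
  · obtain ⟨m, hm⟩ := hb
    exact step_pair hL hm c (Or.inr rfl) h0 h1 h2
  push Not at ha hb
  refine ⟨c, by rw [al_none x ha hb, h0], by rw [al_none x' ha hb, h1], fun k hkc => ?_⟩
  by_cases ha' : ∃ m, (k, m) ∈ L
  · obtain ⟨m, hm⟩ := ha'
    have : m ≠ c := by rintro rfl; exact hb _ hm
    rw [al_fst hL x hm, al_fst hL x' hm, h2 k hkc, h2 m this]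
  by_cases hb' : ∃ m, (m, k) ∈ L
  · obtain ⟨m, hm⟩ := hb'
    have : m ≠ c := by rintro rfl; exact ha _ hm
    rw [al_snd hL x hm, al_snd hL x' hm, h2 k hkc, h2 m this]
  push Not at ha' hb'
  rw [al_none x ha' hb', al_none x' ha' hb', h2 k hkc]

theorem step_net {n : ℕ} (C : List (Finset (Fin n × Fin n))) (hC : ValidNet C)
    {x x' : Fin n → Bool} (h : StepUp x x') : StepUp (applyNet C x) (applyNet C x') := by
  induction C generalizing x x' with
  | nil => exact h
  | cons L C ih =>
    exact ih (fun M hM => hC M (by simp [hM])) (step_layer (hC L (by simp)) h)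

theorem sorted_layer {n : ℕ} {L : Finset (Fin n × Fin n)} (hL : ValidLayer L) {x : Fin n → Bool}
    (h : SortedVec x) : applyLayer L x = x := by
  funext k
  by_cases ha' : ∃ m, (k, m) ∈ L
  · obtain ⟨m, hm⟩ := ha'
    have := h k m (hL.1 _ hm).le
    rw [al_fst hL x hm]
    revert this; cases x k <;> cases x m <;> decide
  by_cases hb' : ∃ m, (m, k) ∈ L
  · obtain ⟨m, hm⟩ := hb'
    have := h m k (hL.1 _ hm).le
    rw [al_snd hL x hm]
    revert this; cases x k <;> cases x m <;> decide
  push Not at ha' hb'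
  rw [al_none x ha' hb']

theorem sorted_net {n : ℕ} (C : List (Finset (Fin n × Fin n))) (hC : ValidNet C)
    {x : Fin n → Bool} (h : SortedVec x) : applyNet C x = x := by
  induction C with
  | nil => rfl
  | cons L C ih =>
    have := ih (fun M hM => hC M (by simp [hM]))
    simp only [applyNet, List.foldl_cons] at this ⊢
    rw [sorted_layer (hC L (by simp)) h]; exact this

theorem sv_true {n : ℕ} {x : Fin n → Bool} (h : SortedVec x) {i j : Fin n} (hij : i ≤ j)
    (hi : x i = true) : x j = true := by
  have := h i j hij
  rw [hi] at this
  revert this; cases x j <;> decide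

theorem key {n : ℕ} {D : List (Finset (Fin n × Fin n))} {L : Finset (Fin n × Fin n)}
    (hD : ValidNet D) (hL : ValidLayer L)
    (hs : ∀ x, SortedVec (applyLayer L (applyNet D x)))
    {i j k : Fin n} (hp : (i, j) ∈ L) (hik : i < k) (hkj : k < j)
    (hk1 : (k : ℕ) = i + 1)
    {x : Fin n → Bool} (hxi : applyNet D x i = true) (hxj : applyNet D x j = false)
    {u d w : Fin n → Bool} (hu : StepUp x u) (hd : StepUp d x) (hdw : StepUp d w)
    (hwu : StepUp w u) :
    applyNet D w i = true ∧ applyNet D w j = false := by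
  -- up-step preserves unless z k = true
  have up : ∀ a b, StepUp a b → applyNet D a i = true → applyNet D a j = false →
      applyLayer L (applyNet D a) k = false →
      applyNet D b i = true ∧ applyNet D b j = false := by
    intro a b hab hi hj hz
    obtain ⟨c, h0, h1, h2⟩ := step_net D hD hab
    have hic : i ≠ c := by rintro rfl; simp [hi] at h0
    have hbi : applyNet D b i = true := by rw [h2 i hic, hi]
    refine ⟨hbi, ?_⟩
    by_contra hbj
    simp only [Bool.not_eq_false] at hbj
    have z0 := al_fst hL (applyNet D a) hp
    have z1 := al_fst hL (applyNet D b) hp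
    rw [hi, hj] at z0
    rw [hbi, hbj] at z1
    obtain ⟨e, g0, g1, g2⟩ := step_layer hL (step_net D hD hab)
    have hie : i = e := by
      by_contra hne
      have := g2 i hne
      simp [z0, z1] at this
    subst hie
    have := sv_true (hs b) hik.le z1
    rw [g2 k hik.ne', hz] at this
    exact absurd this (by decide)
  -- down-step preserves if some m with i < m < j has z m = true
  have down : ∀ a b, StepUp b a → applyNet D a i = true → applyNet D a j = false →
      (∃ m, m < j ∧ applyLayer L (applyNet D a) m = true) →
      applyNet D b i = true ∧ applyNet D b j = false := by
    rintro a b hab hi hj ⟨m, hmj, hz⟩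
    obtain ⟨c, h0, h1, h2⟩ := step_net D hD hab
    have hjc : j ≠ c := by rintro rfl; simp [hj] at h1
    have hbj : applyNet D b j = false := by rw [← h2 j hjc, hj]
    refine ⟨?_, hbj⟩
    by_contra hbi
    simp only [Bool.not_eq_true] at hbi
    have z0 := al_snd hL (applyNet D a) hp
    have z1 := al_snd hL (applyNet D b) hp
    rw [hi, hj] at z0
    rw [hbi, hbj] at z1
    obtain ⟨e, g0, g1, g2⟩ := step_layer hL (step_net D hD hab)
    have hje : j = e := by
      by_contra hne
      have := g2 j hne
      simp [z0, z1] at this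
    subst hje
    rw [g2 m hmj.ne] at hz
    have := sv_true (hs b) hmj.le hz
    rw [z1] at this
    exact absurd this (by decide)
  cases hz : applyLayer L (applyNet D x) k
  · obtain ⟨ui, uj⟩ := up x u hu hxi hxj hz
    refine down u w hwu ui uj ?_
    obtain ⟨e, g0, g1, g2⟩ := step_layer hL (step_net D hD hu)
    refine ⟨e, ?_, g1⟩
    by_contra hle
    have z0 := al_snd hL (applyNet D x) hp
    rw [hxi, hxj] at z0
    have := sv_true (hs x) (not_lt.mp hle) z0
    simp [g0] at this
  · obtain ⟨di, dj⟩ := down x d hd hxi hxj ⟨k, hkj, hz⟩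
    refine up d w hdw di dj ?_
    obtain ⟨e, g0, g1, g2⟩ := step_layer hL (step_net D hD hd)
    have z0 := al_fst hL (applyNet D x) hp
    rw [hxi, hxj] at z0
    have hie : i < e := by
      by_contra hle
      have := sv_true (hs x) (not_lt.mp hle) g1
      simp [z0] at this
    have hke : k ≤ e := by
      rw [Fin.le_def, hk1]; exact hie
    by_contra hne
    simp only [Bool.not_eq_false] at hne
    have := sv_true (hs d) hke hne
    simp [g0] at this

/-- every comparator in the last layer of a non-redundant sorting network
is of the form `(i, i+1)`. -/
theorem last_layer_adjacent {n : ℕ}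
    (C : List (Finset (Fin n × Fin n)))
    (hC : SortingNet C) (hNR : NonRedundant C) :
    ∀ p ∈ C.getD (C.length - 1) ∅, (p.2 : ℕ) = (p.1 : ℕ) + 1 := by
  rintro ⟨i, j⟩ hp
  have hnr := hNR _ _ hp
  rcases List.eq_nil_or_concat C with rfl | ⟨D, L, rfl⟩
  · simp at hp
  simp [Redundant] at hp hnr
  obtain ⟨hV, hS⟩ := hC
  have hD : ValidNet D := fun M hM => hV M (by simp [hM])
  have hL : ValidLayer L := hV L (by simp)
  have hs : ∀ x, SortedVec (applyLayer L (applyNet D x)) := by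
    intro x
    have := hS x
    simpa [applyNet] using this
  have hij : i < j := hL.1 _ hp
  by_contra hne
  simp only at hne
  have hij' : (i : ℕ) < j := hij
  have hjn := j.2
  let k : Fin n := ⟨i + 1, by omega⟩
  have hik : i < k := by simp [Fin.lt_def, k]
  have hkj : k < j := by simp only [Fin.lt_def, k]; omega
  obtain ⟨x0, hx0⟩ := hnr
  let A : Finset (Fin n → Bool) :=
    Finset.univ.filter (fun x => applyNet D x i = true ∧ applyNet D x j = false)
  have hA : A.Nonempty := ⟨x0, by
    simp only [A, Finset.mem_filter, Finset.mem_univ, true_and]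
    revert hx0; cases applyNet D x0 i <;> cases applyNet D x0 j <;> decide⟩
  obtain ⟨x, hxA, hmax⟩ := Finset.exists_max_image A
    (fun x => ∑ c : Fin n, if x c = true then (c : ℕ) else 0) hA
  simp only [A, Finset.mem_filter, Finset.mem_univ, true_and] at hxA hmax
  by_cases hsx : SortedVec x
  · have e := sorted_net D hD hsx
    rw [e] at hxA
    have := sv_true hsx hij.le hxA.1
    simp [hxA.2] at this
  · simp only [SortedVec, not_forall] at hsx
    obtain ⟨a, b, hab, hlt⟩ := hsx
    have hxa : x a = true := by
      revert hlt; cases x a <;> cases x b <;> decide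
    have hxb : x b = false := by
      revert hlt; cases x a <;> cases x b <;> decide
    have hab' : a ≠ b := by rintro rfl; simp [hxa] at hxb
    have hablt : (a : ℕ) < b := Fin.lt_def.mp (lt_of_le_of_ne hab hab')
    have hw := key hD hL hs hp hik hkj rfl hxA.1 hxA.2
      (u := Function.update x b true) (d := Function.update x a false)
      (w := Function.update (Function.update x a false) b true)
      ⟨b, hxb, by simp, fun k hk => by simp [hk]⟩
      ⟨a, by simp, hxa, fun k hk => by simp [hk]⟩
      ⟨b, by simp [hab'.symm, hxb], by simp, fun k hk => by simp [hk]⟩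
      ⟨a, by simp [hab'], by simp [hab', hxa], fun k hk => by
        simp [Function.update_apply, hk]⟩
    have hle := hmax _ hw
    have hsum : ∀ y : Fin n → Bool, (∑ c : Fin n, if y c = true then (c : ℕ) else 0) =
        (if y a = true then (a : ℕ) else 0) + ((if y b = true then (b : ℕ) else 0) +
        ∑ c ∈ (Finset.univ.erase a).erase b, if y c = true then (c : ℕ) else 0) := by
      intro y
      rw [Finset.add_sum_erase _ (fun c : Fin n => if y c = true then (c : ℕ) else 0)
          (by simp [hab'.symm]),
        Finset.add_sum_erase _ (fun c : Fin n => if y c = true then (c : ℕ) else 0) (by simp)]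
    rw [hsum, hsum x] at hle
    have hrest : (∑ c ∈ (Finset.univ.erase a).erase b,
        if Function.update (Function.update x a false) b true c = true then (c : ℕ) else 0) =
        ∑ c ∈ (Finset.univ.erase a).erase b, if x c = true then (c : ℕ) else 0 := by
      apply Finset.sum_congr rfl
      intro c hc
      simp only [Finset.mem_erase, Finset.mem_univ, and_true] at hc
      simp [Function.update_apply, hc.1, hc.2]
    rw [hrest] at hle
    simp [hab', hxa, hxb] at hle
    omega
end

section
/- Suppose C is a non-redundant sorting network on n channels of depth d that contains a comparator (i,j) at layer k with j > i+1. Then at least one of the channels i and j is used by some comparator in a layer k' of C with k' > k. -/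
/-- Channel `c` is used in layer `L`. -/
def UsedIn {n : ℕ} (c : Fin n) (L : Finset (Fin n × Fin n)) : Prop :=
  ∃ q ∈ L, q.1 = c ∨ q.2 = c


lemma layer_mono {n : ℕ} (L : Finset (Fin n × Fin n)) {x y : Fin n → Bool}
    (h : ∀ c, x c = true → y c = true) (c : Fin n) :
    applyLayer L x c = true → applyLayer L y c = true := by
  simp only [applyLayer, Bool.or_eq_true, Bool.and_eq_true, decide_eq_true_eq]
  rintro (⟨h1, h2⟩ | ⟨i, h1, h2⟩)
  · exact Or.inl ⟨h _ h1, fun j hj => h _ (h2 j hj)⟩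
  · exact Or.inr ⟨i, h1, h _ h2⟩

lemma net_mono {n : ℕ} (C : List (Finset (Fin n × Fin n))) : ∀ {x y : Fin n → Bool},
    (∀ c, x c = true → y c = true) → ∀ c, applyNet C x c = true → applyNet C y c = true := by
  induction C with
  | nil => intro x y h; exact h
  | cons L C ih => intro x y h; exact ih (layer_mono L h)

lemma layer_fst {n : ℕ} {L : Finset (Fin n × Fin n)} (hL : ValidLayer L) {p : Fin n × Fin n}
    (hp : p ∈ L) (x : Fin n → Bool) : applyLayer L x p.1 = (x p.1 && x p.2) := by
  have h1 : ∀ i, (i, p.1) ∉ L := by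
    intro i hi
    have h3 := hL.1 p hp
    by_cases e : p = (i, p.1)
    · have := congrArg Prod.snd e
      simp only at this
      rw [this] at h3; exact lt_irrefl _ h3
    · exact (hL.2 p hp _ hi e).2.1 rfl
  have h2 : ∀ j, (p.1, j) ∈ L ↔ j = p.2 := by
    intro j
    constructor
    · intro hj
      by_cases e : p = (p.1, j)
      · exact (congrArg Prod.snd e).symm
      · exact absurd rfl (hL.2 p hp _ hj e).1
    · rintro rfl; exact hp
  simp [applyLayer, h1, h2]

lemma layer_snd {n : ℕ} {L : Finset (Fin n × Fin n)} (hL : ValidLayer L) {p : Fin n × Fin n}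
    (hp : p ∈ L) (x : Fin n → Bool) : applyLayer L x p.2 = (x p.1 || x p.2) := by
  have h1 : ∀ i, (p.2, i) ∉ L := by
    intro i hi
    have h3 := hL.1 p hp
    by_cases e : p = (p.2, i)
    · have := congrArg Prod.fst e
      simp only at this
      rw [this] at h3; exact lt_irrefl _ h3
    · exact (hL.2 p hp _ hi e).2.2.1 rfl
  have h2 : ∀ j, (j, p.2) ∈ L ↔ j = p.1 := by
    intro j
    constructor
    · intro hj
      by_cases e : p = (j, p.2)
      · exact (congrArg Prod.fst e).symm
      · exact absurd rfl (hL.2 p hp _ hj e).2.2.2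
    · rintro rfl; exact hp
  simp [applyLayer, h1, h2, Bool.or_comm]

lemma layer_unused {n : ℕ} {L : Finset (Fin n × Fin n)} {c : Fin n}
    (hc : ¬ UsedIn c L) (x : Fin n → Bool) : applyLayer L x c = x c := by
  have h1 : ∀ i, (c, i) ∉ L := fun i hi => hc ⟨_, hi, Or.inl rfl⟩
  have h2 : ∀ i, (i, c) ∉ L := fun i hi => hc ⟨_, hi, Or.inr rfl⟩
  simp [applyLayer, h1, h2]

lemma net_unused {n : ℕ} (C : List (Finset (Fin n × Fin n))) {c : Fin n} :
    (∀ L ∈ C, ¬ UsedIn c L) → ∀ x : Fin n → Bool, applyNet C x c = x c := by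
  induction C with
  | nil => intro _ x; rfl
  | cons L C ih =>
    intro h x
    have := ih (fun M hM => h M (List.mem_cons_of_mem _ hM)) (applyLayer L x)
    exact this.trans (layer_unused (h L List.mem_cons_self) x)

lemma layer_sorted {n : ℕ} {L : Finset (Fin n × Fin n)} (hL : ValidLayer L)
    {x : Fin n → Bool} (hx : SortedVec x) : applyLayer L x = x := by
  funext c
  by_cases hc : UsedIn c L
  · obtain ⟨q, hq, rfl | rfl⟩ := hc
    · have h := hx _ _ (hL.1 q hq).le
      rw [layer_fst hL hq]
      revert h; cases x q.1 <;> cases x q.2 <;> decide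
    · have h := hx _ _ (hL.1 q hq).le
      rw [layer_snd hL hq]
      revert h; cases x q.1 <;> cases x q.2 <;> decide
  · exact layer_unused hc x

lemma net_sorted {n : ℕ} (C : List (Finset (Fin n × Fin n))) (hC : ValidNet C)
    {x : Fin n → Bool} (hx : SortedVec x) : applyNet C x = x := by
  induction C with
  | nil => rfl
  | cons L C ih =>
    change applyNet C (applyLayer L x) = x
    rw [layer_sorted (hC L List.mem_cons_self) hx]
    exact ih (fun M hM => hC M (List.mem_cons_of_mem _ hM))

def wtv {n : ℕ} (x : Fin n → Bool) : ℕ := ∑ c, (x c).toNat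

lemma layer_wt {n : ℕ} {L : Finset (Fin n × Fin n)} (hL : ValidLayer L)
    (x : Fin n → Bool) : wtv (applyLayer L x) = wtv x := by
  classical
  have key : ∀ c, ∃ e, applyLayer L x c = x e ∧
      (((c, e) ∈ L ∧ x c = true ∧ x e = false) ∨ ((e, c) ∈ L ∧ x e = true ∧ x c = false) ∨
        (c = e ∧ ∀ d, ((c, d) ∈ L → ¬ (x c = true ∧ x d = false)) ∧
          ((d, c) ∈ L → ¬ (x d = true ∧ x c = false)))) := by
    intro c
    by_cases h1 : ∃ e, (c, e) ∈ L ∧ x c = true ∧ x e = false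
    · obtain ⟨e, h, h2, h3⟩ := h1
      exact ⟨e, by simpa [h2, h3] using layer_fst hL h x, Or.inl ⟨h, h2, h3⟩⟩
    by_cases h4 : ∃ e, (e, c) ∈ L ∧ x e = true ∧ x c = false
    · obtain ⟨e, h, h2, h3⟩ := h4
      exact ⟨e, by simpa [h2, h3] using layer_snd hL h x, Or.inr (Or.inl ⟨h, h2, h3⟩)⟩
    push Not at h1 h4
    refine ⟨c, ?_, Or.inr (Or.inr ⟨rfl, fun d => ⟨fun h h' => h1 d h h'.1 h'.2,
      fun h h' => h4 d h h'.1 h'.2⟩⟩)⟩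
    by_cases hc : UsedIn c L
    · obtain ⟨q, hq, rfl | rfl⟩ := hc
      · have := h1 q.2 hq
        rw [layer_fst hL hq]
        revert this; cases x q.1 <;> cases x q.2 <;> simp
      · have := h4 q.1 hq
        rw [layer_snd hL hq]
        revert this; cases x q.1 <;> cases x q.2 <;> simp
    · exact layer_unused hc x
  choose f hf1 hf2 using key
  have hV : ∀ a b c d, (a, b) ∈ L → (c, d) ∈ L → (a = c ∧ b = d) ∨
      (a ≠ c ∧ a ≠ d ∧ b ≠ c ∧ b ≠ d) := by
    intro a b c d h h'
    by_cases e : (a, b) = (c, d)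
    · left; simpa using e
    · right; exact hL.2 _ h _ h' e
  have hinj : Function.Injective f := by
    intro a b hab
    have ha := hf2 a
    have hb := hf2 b
    rw [hab] at ha
    generalize f b = e at ha hb
    clear hf1 hf2 hab
    rcases ha with ⟨a1, a2, a3⟩ | ⟨a1, a2, a3⟩ | ⟨a1, a2⟩ <;>
    rcases hb with ⟨b1, b2, b3⟩ | ⟨b1, b2, b3⟩ | ⟨b1, b2⟩
    · have := hV _ _ _ _ a1 b1; tauto
    · simp_all
    · subst b1; exact absurd ⟨a2, a3⟩ ((b2 a).2 a1)
    · simp_all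
    · have := hV _ _ _ _ a1 b1; tauto
    · subst b1; exact absurd ⟨a2, a3⟩ ((b2 a).1 a1)
    · subst a1; exact absurd ⟨b2, b3⟩ ((a2 b).2 b1)
    · subst a1; exact absurd ⟨b2, b3⟩ ((a2 b).1 b1)
    · exact a1.trans b1.symm
  have hbij := Finite.injective_iff_bijective.mp hinj
  unfold wtv
  simp_rw [hf1]
  exact hbij.sum_comp (fun c => (x c).toNat)

lemma net_wt {n : ℕ} (C : List (Finset (Fin n × Fin n))) (hC : ValidNet C) :
    ∀ x : Fin n → Bool, wtv (applyNet C x) = wtv x := by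
  induction C with
  | nil => intro x; rfl
  | cons L C ih =>
    intro x
    exact (ih (fun M hM => hC M (List.mem_cons_of_mem _ hM)) _).trans
      (layer_wt (hC L List.mem_cons_self) x)

lemma sorted_iff {n : ℕ} {u : Fin n → Bool} (hu : SortedVec u) (c : Fin n) :
    u c = true ↔ n ≤ c + wtv u := by
  have hw : wtv u = (Finset.univ.filter (fun c => u c = true)).card := by
    rw [Finset.card_filter]
    unfold wtv
    refine Finset.sum_congr rfl fun c _ => ?_
    cases u c <;> rfl
  constructor
  · intro h
    have : Finset.Ici c ⊆ Finset.univ.filter (fun c => u c = true) := by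
      intro d hd
      have := hu c d (Finset.mem_Ici.mp hd)
      rw [h] at this
      simp only [Finset.mem_filter, Finset.mem_univ, true_and]
      revert this; cases u d <;> decide
    have := Finset.card_le_card this
    rw [Fin.card_Ici] at this
    omega
  · intro h
    by_contra hc
    have : Finset.univ.filter (fun c => u c = true) ⊆ Finset.Ioi c := by
      intro d hd
      simp only [Finset.mem_filter, Finset.mem_univ, true_and] at hd
      rw [Finset.mem_Ioi]
      by_contra hdc
      have := hu d c (not_lt.mp hdc)
      rw [hd] at this
      revert this hc; cases u c <;> decide
    have := Finset.card_le_card this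
    rw [Fin.card_Ioi] at this
    have := c.2
    omega

lemma wt_update {n : ℕ} (x : Fin n → Bool) (b : Fin n) (hb : x b = false) (g : Fin n → ℕ) :
    ∑ c, g c * (Function.update x b true c).toNat = (∑ c, g c * (x c).toNat) + g b := by
  have : ∀ c, g c * (Function.update x b true c).toNat
      = g c * (x c).toNat + if c = b then g b else 0 := by
    intro c
    by_cases h : c = b
    · subst h; simp [hb]
    · simp [h]
  simp_rw [this, Finset.sum_add_distrib]
  simp

theorem nonadjacent_comparator_used_later {n : ℕ}
    (C : List (Finset (Fin n × Fin n)))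
    (hC : SortingNet C) (hNR : NonRedundant C)
    (k : ℕ) (p : Fin n × Fin n) (hp : p ∈ C.getD k ∅)
    (hij : (p.1 : ℕ) + 1 < (p.2 : ℕ)) :
    ∃ L ∈ C.drop (k + 1), UsedIn p.1 L ∨ UsedIn p.2 L := by
  by_contra hcon
  push Not at hcon
  have hk : k < C.length := by
    by_contra h
    rw [List.getD_eq_default _ _ (not_lt.mp h)] at hp
    simp at hp
  rw [List.getD_eq_getElem _ _ hk] at hp
  have hLv : ValidLayer C[k] := hC.1 _ (List.getElem_mem hk)
  have hsplit : ∀ x, applyNet C x =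
      applyNet (C.drop (k+1)) (applyLayer C[k] (applyNet (C.take k) x)) := by
    intro x
    have : C = C.take k ++ C[k] :: C.drop (k+1) := by simp
    conv_lhs => rw [this]
    simp only [applyNet, List.foldl_append, List.foldl_cons]
  have hi : ∀ x, applyNet C x p.1 = (applyNet (C.take k) x p.1 && applyNet (C.take k) x p.2) := by
    intro x
    rw [hsplit, net_unused _ (fun L hL => (hcon L hL).1), layer_fst hLv hp]
  have hj : ∀ x, applyNet C x p.2 = (applyNet (C.take k) x p.1 || applyNet (C.take k) x p.2) := by
    intro x
    rw [hsplit, net_unused _ (fun L hL => (hcon L hL).2), layer_snd hLv hp]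
  have hs : ∀ x c, applyNet C x c = true ↔ n ≤ c + wtv x := by
    intro x c
    rw [sorted_iff (hC.2 x) c, net_wt C hC.1]
  have hPm := fun {x y : Fin n → Bool} => net_mono (C.take k) (x := x) (y := y)
  have hPs : ∀ x, SortedVec x → applyNet (C.take k) x = x := fun x hx =>
    net_sorted _ (fun L hL => hC.1 L (List.mem_of_mem_take hL)) hx
  have hi' : ∀ x, (applyNet (C.take k) x p.1 = true ∧ applyNet (C.take k) x p.2 = true) ↔
      n ≤ p.1 + wtv x := fun x => by rw [← hs, hi]; simp
  have hj' : ∀ x, (applyNet (C.take k) x p.1 = true ∨ applyNet (C.take k) x p.2 = true) ↔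
      n ≤ p.2 + wtv x := fun x => by rw [← hs, hj]; simp
  have hred := hNR k p (by rw [List.getD_eq_getElem _ _ hk]; exact hp)
  unfold Redundant at hred
  generalize applyNet (C.take k) = P at *
  clear hi hj hs hsplit hNR
  push Not at hred
  obtain ⟨x0, hx0⟩ := hred
  have hx0' : P x0 p.1 = true ∧ P x0 p.2 = false := by
    revert hx0; cases P x0 p.1 <;> cases P x0 p.2 <;> decide
  let S : Finset (Fin n → Bool) := Finset.univ.filter
    (fun x => P x p.1 = true ∧ P x p.2 = false)
  obtain ⟨x, hxS, hmax⟩ := S.exists_max_image (fun x => ∑ c : Fin n, (c : ℕ) * (x c).toNat)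
    ⟨x0, by simpa [S] using hx0'⟩
  simp only [S, Finset.mem_filter, Finset.mem_univ, true_and] at hxS hmax
  obtain ⟨hx1, hx2⟩ := hxS
  by_cases hsx : SortedVec x
  · have := hsx p.1 p.2 (Fin.le_def.mpr (by omega))
    rw [hPs x hsx] at hx1 hx2
    rw [hx1, hx2] at this
    revert this; decide
  unfold SortedVec at hsx
  push Not at hsx
  obtain ⟨a, b, hab, hlt⟩ := hsx
  have hxa : x a = true ∧ x b = false := by
    revert hlt; cases x a <;> cases x b <;> decide
  obtain ⟨hxa, hxb⟩ := hxa
  have hne : a ≠ b := by rintro rfl; simp [hxa] at hxb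
  have hablt : (a : ℕ) < b := by
    have := lt_of_le_of_ne hab hne
    exact this
  obtain ⟨z', hz'⟩ : ∃ z', z' = Function.update x a false := ⟨_, rfl⟩
  obtain ⟨z, hz⟩ : ∃ z, z = Function.update x b true := ⟨_, rfl⟩
  obtain ⟨y, hy⟩ : ∃ y, y = Function.update z' b true := ⟨_, rfl⟩
  have hxz : x = Function.update z' a true := by
    rw [hz', Function.update_idem, ← hxa, Function.update_eq_self]
  have hz'a : z' a = false := by simp [hz']
  have hz'b : z' b = false := by simp [hz', hne.symm, hxb]
  have m1 : ∀ c, z' c = true → x c = true := by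
    intro c h; rw [hxz]; by_cases e : c = a <;> simp [e, h]
  have m2 : ∀ c, z' c = true → y c = true := by
    intro c h; rw [hy]; by_cases e : c = b <;> simp [e, h]
  have m3 : ∀ c, x c = true → z c = true := by
    intro c h; rw [hz]; by_cases e : c = b <;> simp [e, h]
  have m4 : ∀ c, y c = true → z c = true := by
    intro c
    by_cases e : c = b
    · simp [hz, e]
    · rw [hy, hz, Function.update_of_ne e, Function.update_of_ne e]; exact m1 c
  have w1 := wt_update z' a hz'a
  rw [← hxz] at w1
  have w2 := wt_update z' b hz'b
  rw [← hy] at w2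
  have w3 := wt_update x b hxb
  rw [← hz] at w3
  have v1 := w1 (fun _ => 1)
  have v2 := w2 (fun _ => 1)
  have v3 := w3 (fun _ => 1)
  simp only [one_mul] at v1 v2 v3
  change wtv x = wtv z' + 1 at v1
  change wtv y = wtv z' + 1 at v2
  change wtv z = wtv x + 1 at v3
  have u1 := w1 (fun c => c)
  have u2 := w2 (fun c => c)
  have hyb : ¬ (P y p.1 = true ∧ P y p.2 = false) := by
    intro h
    have := hmax y h
    omega
  have ix := hi' x
  have jx := hj' x
  have iy := hi' y
  have jy := hj' y
  have iz := hi' z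
  have jz := hj' z
  have iz' := hi' z'
  have jz' := hj' z'
  have wx1 : ¬ n ≤ p.1 + wtv x := by rw [← ix]; simp [hx2]
  have wx2 : n ≤ p.2 + wtv x := by rw [← jx]; simp [hx1]
  have wy1 : ¬ (P y p.1 = true ∧ P y p.2 = true) := by rw [iy]; omega
  have wy2 : (P y p.1 = true ∨ P y p.2 = true) := by rw [jy]; omega
  by_cases hm : n ≤ p.1 + 1 + wtv x
  · have a2 : P z' p.1 = true ∨ P z' p.2 = true := by rw [jz']; omega
    have a3 := hPm m1 p.2
    have a4 := hPm m2 p.1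
    clear * - a2 a3 a4 hx2 hyb wy1 wy2
    cases h1 : P y p.1 <;> cases h2 : P y p.2 <;> simp_all
  · have a1 : ¬ (P z p.1 = true ∧ P z p.2 = true) := by rw [iz]; omega
    have a3 := hPm m3 p.1
    have a4 := hPm m4 p.2
    clear * - a1 a3 a4 hx1 hyb wy1 wy2
    cases h1 : P y p.1 <;> cases h2 : P y p.2 <;> simp_all
end

section
/- Let C be a sorting network of depth d on n channels without redundant comparators. Then every comparator in layer d−1 of C connects adjacent blocks of C: if (i,j) is a comparator in layer L_{d−1}, then i and j belong to two distinct (d−1)-blocks A and B of C that are adjacent. -/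
/-- Channels `i` and `j` are in the same `k`-block: the equivalence relation generated
by the comparators occurring in the layers of 0-based index ≥ `k` (that is, the layers
`L_{k'}` with `k' > k` in the 1-based numbering of the layers `L_1;…;L_d`). -/
def blockRel {n : ℕ} (C : List (Finset (Fin n × Fin n))) (k : ℕ) : Fin n → Fin n → Prop :=
  Relation.EqvGen (fun i j => ∃ L ∈ C.drop k, (i, j) ∈ L ∨ (j, i) ∈ L)

/-- `B` is a `k`-block of `C`: an equivalence class of `blockRel C k`. -/
def IsBlock {n : ℕ} (C : List (Finset (Fin n × Fin n))) (k : ℕ) (B : Finset (Fin n)) : Prop :=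
  ∃ i : Fin n, ∀ j : Fin n, j ∈ B ↔ blockRel C k i j

/-- Two distinct blocks `A` and `B` are adjacent: `max A + 1 = min B` or `max B + 1 = min A`. -/
def AdjacentBlocks {n : ℕ} (A B : Finset (Fin n)) : Prop :=
  A ≠ B ∧ ∃ (hA : A.Nonempty) (hB : B.Nonempty),
    ((A.max' hA : ℕ) + 1 = (B.min' hB : ℕ)) ∨ ((B.max' hB : ℕ) + 1 = (A.min' hA : ℕ))

theorem aux_comb {α : Type*} [DecidableEq α] [Fintype α] (t : ℕ) (g h : Finset α → Prop)
    (hg : ∀ S T, S ⊆ T → g S → g T) (hh : ∀ S T, S ⊆ T → h S → h T)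
    (h0 : ∀ S : Finset α, S.card = t → (g S ↔ ¬ h S))
    (h1 : ∀ S : Finset α, S.card = t + 1 → (g S ↔ ¬ h S))
    (S0 : Finset α) (hS0 : S0.card = t) (hh0 : h S0) : ∀ S, g S → h S := by
  have key : ∀ k : ℕ, ∀ S : Finset α, S.card = t → (S \ S0).card = k → h S := by
    intro k
    induction k with
    | zero =>
      intro S hS hk
      have hsub : S ⊆ S0 := by
        rw [Finset.card_eq_zero] at hk
        exact Finset.sdiff_eq_empty_iff_subset.mp hk
      have : S = S0 := Finset.eq_of_subset_of_card_le hsub (by omega)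
      rwa [this]
    | succ k ih =>
      intro S hS hk
      have hc : (S0 \ S).card = k + 1 := by
        have := Finset.card_sdiff_add_card_inter S S0
        have h2 := Finset.card_sdiff_add_card_inter S0 S
        rw [Finset.inter_comm] at h2
        omega
      obtain ⟨a, ha⟩ : (S \ S0).Nonempty := Finset.card_pos.mp (by omega)
      obtain ⟨b, hb⟩ : (S0 \ S).Nonempty := Finset.card_pos.mp (by omega)
      rw [Finset.mem_sdiff] at ha hb
      have hab : a ≠ b := fun e => ha.2 (e ▸ hb.1)
      have hU : (insert b S).card = t + 1 := by
        rw [Finset.card_insert_of_notMem hb.2, hS]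
      have hS' : ((insert b S).erase a).card = t := by
        rw [Finset.card_erase_of_mem (Finset.mem_insert_of_mem ha.1), hU]; rfl
      have hd : ((insert b S).erase a) \ S0 = (S \ S0).erase a := by
        ext c
        simp only [Finset.mem_sdiff, Finset.mem_erase, Finset.mem_insert]
        constructor
        · rintro ⟨⟨h1, rfl | h2⟩, h3⟩
          · exact absurd hb.1 h3
          · exact ⟨h1, h2, h3⟩
        · rintro ⟨h1, h2, h3⟩
          exact ⟨⟨h1, Or.inr h2⟩, h3⟩
      have h5 : h ((insert b S).erase a) := by
        apply ih _ hS'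
        rw [hd, Finset.card_erase_of_mem (Finset.mem_sdiff.mpr ha), hk]; rfl
      have h6 : h (insert b S) := hh _ _ (Finset.erase_subset _ _) h5
      have h7 : ¬ g (insert b S) := fun hgg => (h1 _ hU).mp hgg h6
      have h8 : ¬ g S := fun hgg => h7 (hg _ _ (Finset.subset_insert _ _) hgg)
      by_contra hn
      exact h8 ((h0 S hS).mpr hn)
  intro S hgS
  rcases le_total S.card t with hle | hle
  · obtain ⟨T, hST, hT⟩ := Finset.exists_superset_card_eq hle
      (by rw [← hS0]; exact Finset.card_le_univ _)
    exact absurd (key _ T hT rfl) ((h0 T hT).mp (hg _ _ hST hgS))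
  · obtain ⟨T, hTS, hT⟩ := Finset.exists_subset_card_eq hle
    exact hh _ _ hTS (key _ T hT rfl)

theorem applyLayer_true {n : ℕ} (L : Finset (Fin n × Fin n)) (x : Fin n → Bool) (c : Fin n) :
    applyLayer L x c = true ↔
      (x c = true ∧ ∀ j, (c, j) ∈ L → x j = true) ∨ ∃ i, (i, c) ∈ L ∧ x i = true := by
  simp [applyLayer]

theorem vl_ll {n : ℕ} {L : Finset (Fin n × Fin n)} (hL : ValidLayer L) {a b c : Fin n}
    (h : (a, b) ∈ L) (h' : (a, c) ∈ L) : b = c := by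
  by_contra hne
  exact (hL.2 _ h _ h' (by simp [hne])).1 rfl

theorem vl_rr {n : ℕ} {L : Finset (Fin n × Fin n)} (hL : ValidLayer L) {a b c : Fin n}
    (h : (b, a) ∈ L) (h' : (c, a) ∈ L) : b = c := by
  by_contra hne
  exact (hL.2 _ h _ h' (by simp [hne])).2.2.2 rfl

theorem vl_lr {n : ℕ} {L : Finset (Fin n × Fin n)} (hL : ValidLayer L) {a b c : Fin n}
    (h : (a, b) ∈ L) (h' : (c, a) ∈ L) : False := by
  have h1 := hL.1 _ h
  have h2 := hL.1 _ h'
  refine (hL.2 _ h _ h' ?_).2.1 rfl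
  intro e
  rw [Prod.mk.injEq] at e
  simp only at h1 h2
  rw [e.1] at h2
  exact lt_irrefl _ h2

theorem applyLayer_top {n : ℕ} {L : Finset (Fin n × Fin n)} (hL : ValidLayer L)
    (x : Fin n → Bool) {a b : Fin n} (h : (a, b) ∈ L) :
    applyLayer L x a = true ↔ x a = true ∧ x b = true := by
  rw [applyLayer_true]
  constructor
  · rintro (⟨h1, h2⟩ | ⟨i, h1, _⟩)
    · exact ⟨h1, h2 _ h⟩
    · exact (vl_lr hL h h1).elim
  · rintro ⟨h1, h2⟩
    exact Or.inl ⟨h1, fun j hj => vl_ll hL h hj ▸ h2⟩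

theorem applyLayer_bot {n : ℕ} {L : Finset (Fin n × Fin n)} (hL : ValidLayer L)
    (x : Fin n → Bool) {a b : Fin n} (h : (a, b) ∈ L) :
    applyLayer L x b = true ↔ x a = true ∨ x b = true := by
  rw [applyLayer_true]
  constructor
  · rintro (⟨h1, h2⟩ | ⟨i, h1, h2⟩)
    · exact Or.inr h1
    · exact Or.inl (vl_rr hL h1 h ▸ h2)
  · rintro (h1 | h1)
    · exact Or.inr ⟨a, h, h1⟩
    · exact Or.inl ⟨h1, fun j hj => (vl_lr hL hj h).elim⟩

theorem applyLayer_none {n : ℕ} {L : Finset (Fin n × Fin n)}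
    (x : Fin n → Bool) {a : Fin n} (h : ∀ b, (a, b) ∉ L) (h' : ∀ b, (b, a) ∉ L) :
    applyLayer L x a = true ↔ x a = true := by
  rw [applyLayer_true]
  constructor
  · rintro (⟨h1, h2⟩ | ⟨i, h1, h2⟩)
    · exact h1
    · exact (h' _ h1).elim
  · intro h1
    exact Or.inl ⟨h1, fun j hj => (h _ hj).elim⟩

theorem applyLayer_mono {n : ℕ} (L : Finset (Fin n × Fin n)) (x y : Fin n → Bool)
    (h : ∀ c, x c = true → y c = true) (c : Fin n) :
    applyLayer L x c = true → applyLayer L y c = true := by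
  rw [applyLayer_true, applyLayer_true]
  rintro (⟨h1, h2⟩ | ⟨i, h1, h2⟩)
  · exact Or.inl ⟨h _ h1, fun j hj => h _ (h2 j hj)⟩
  · exact Or.inr ⟨i, h1, h _ h2⟩

theorem applyNet_mono {n : ℕ} (C : List (Finset (Fin n × Fin n))) : ∀ (x y : Fin n → Bool),
    (∀ c, x c = true → y c = true) → ∀ c, applyNet C x c = true → applyNet C y c = true := by
  induction C with
  | nil => intro x y h c; exact h c
  | cons L C ih =>
    intro x y h c
    exact ih _ _ (applyLayer_mono L x y h) c

theorem applyLayer_sorted {n : ℕ} {L : Finset (Fin n × Fin n)} (hL : ValidLayer L)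
    (x : Fin n → Bool) (hx : ∀ i j, i ≤ j → x i = true → x j = true) : applyLayer L x = x := by
  funext c
  rw [Bool.eq_iff_iff, applyLayer_true]
  constructor
  · rintro (⟨h1, h2⟩ | ⟨i, h1, h2⟩)
    · exact h1
    · exact hx i c (hL.1 _ h1).le h2
  · intro h
    exact Or.inl ⟨h, fun j hj => hx c j (hL.1 _ hj).le h⟩

theorem applyNet_sorted {n : ℕ} (C : List (Finset (Fin n × Fin n))) (hC : ValidNet C)
    (x : Fin n → Bool) (hx : ∀ i j, i ≤ j → x i = true → x j = true) : applyNet C x = x := by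
  induction C with
  | nil => rfl
  | cons L C ih =>
    change applyNet C (applyLayer L x) = x
    rw [applyLayer_sorted (hC L (by simp)) x hx]
    exact ih (fun L' h => hC L' (by simp [h]))

theorem applyLayer_card {n : ℕ} {L : Finset (Fin n × Fin n)} (hL : ValidLayer L)
    (x : Fin n → Bool) : (Finset.univ.filter (fun c => applyLayer L x c = true)).card =
      (Finset.univ.filter (fun c => x c = true)).card := by
  classical
  have key : ∀ c, ∃ c', (c' = c ∧ (applyLayer L x c = true ↔ x c = true) ∧
        (∀ b, (c, b) ∈ L → ¬ (x c = true ∧ x b = false)) ∧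
        (∀ b, (b, c) ∈ L → ¬ (x b = true ∧ x c = false))) ∨
      ((c, c') ∈ L ∧ x c = true ∧ x c' = false) ∨ ((c', c) ∈ L ∧ x c' = true ∧ x c = false) := by
    intro c
    by_cases h1 : ∃ b, (c, b) ∈ L ∧ (x c = true ∧ x b = false)
    · obtain ⟨b, h⟩ := h1
      exact ⟨b, Or.inr (Or.inl h)⟩
    by_cases h2 : ∃ b, (b, c) ∈ L ∧ (x b = true ∧ x c = false)
    · obtain ⟨b, h⟩ := h2
      exact ⟨b, Or.inr (Or.inr h)⟩
    push Not at h1 h2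
    refine ⟨c, Or.inl ⟨rfl, ?_, fun b hb hx => h1 b hb hx.1 hx.2, fun b hb hx => h2 b hb hx.1 hx.2⟩⟩
    rw [applyLayer_true]
    constructor
    · rintro (h | ⟨i, hi, hxi⟩)
      · exact h.1
      · simpa using h2 i hi hxi
    · intro h
      exact Or.inl ⟨h, fun j hj => by simpa using h1 j hj h⟩
  choose σ hσ using key
  have hval : ∀ c, applyLayer L x c = true ↔ x (σ c) = true := by
    intro c
    rcases hσ c with ⟨h1, h2, _⟩ | ⟨h1, h2, h3⟩ | ⟨h1, h2, h3⟩
    · rw [h1]; exact h2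
    · rw [applyLayer_top hL x h1]; simp [h3]
    · rw [applyLayer_bot hL x h1]; simp [h2]
  have hinv : ∀ c, σ (σ c) = c := by
    intro c
    rcases hσ c with ⟨h1, h2, _⟩ | ⟨h1, h2, h3⟩ | ⟨h1, h2, h3⟩
    · rw [h1, h1]
    · rcases hσ (σ c) with ⟨_, _, _, h4⟩ | ⟨h4, _⟩ | ⟨h4, _⟩
      · exact (h4 _ h1 ⟨h2, h3⟩).elim
      · exact (vl_lr hL h4 h1).elim
      · exact vl_rr hL h4 h1
    · rcases hσ (σ c) with ⟨_, _, h4, _⟩ | ⟨h4, _⟩ | ⟨h4, _⟩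
      · exact (h4 _ h1 ⟨h2, h3⟩).elim
      · exact vl_ll hL h4 h1
      · exact (vl_lr hL h1 h4).elim
  apply Finset.card_bij' (fun c _ => σ c) (fun c _ => σ c)
  · intro c hc
    simpa [hval] using hc
  · intro c hc
    simpa [hval, hinv] using hc
  · intro c _; exact hinv c
  · intro c _; exact hinv c

theorem applyNet_card {n : ℕ} (C : List (Finset (Fin n × Fin n))) (hC : ValidNet C) :
    ∀ (x : Fin n → Bool), (Finset.univ.filter (fun c => applyNet C x c = true)).card =
      (Finset.univ.filter (fun c => x c = true)).card := by
  induction C with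
  | nil => intro x; rfl
  | cons L C ih =>
    intro x
    rw [← applyLayer_card (hC L (by simp)) x]
    exact ih (fun L' h => hC L' (by simp [h])) _

theorem sorted_out {n : ℕ} (C : List (Finset (Fin n × Fin n))) (hC : SortingNet C)
    (x : Fin n → Bool) (U : Finset (Fin n)) (hU : IsUpperSet (U : Set (Fin n)))
    (hc : (Finset.univ.filter (fun c => x c = true)).card = U.card) (c : Fin n) :
    applyNet C x c = true ↔ c ∈ U := by
  set V := Finset.univ.filter (fun c => applyNet C x c = true) with hVdef
  have hV : IsUpperSet (V : Set (Fin n)) := by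
    intro a b hab ha
    have := hC.2 x a b hab
    simp only [hVdef, Finset.coe_filter, Finset.mem_univ, true_and, Set.mem_ofPred_eq] at ha ⊢
    exact Bool.le_iff_imp.mp this ha
  have hcard : V.card = U.card := by rw [← hc]; exact applyNet_card C hC.1 x
  have : V = U := by
    rcases hV.total hU with h | h
    · exact Finset.eq_of_subset_of_card_le (by exact_mod_cast h) hcard.ge
    · exact (Finset.eq_of_subset_of_card_le (by exact_mod_cast h) hcard.le).symm
  rw [← this]; simp [hVdef]

theorem aux_main {n : ℕ} (C P : List (Finset (Fin n × Fin n))) (hC : SortingNet C)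
    (hP : ValidNet P) (i j m : Fin n) (hmj : m < j)
    (H : ∀ x : Fin n → Bool, (∀ c, c < m → applyNet C x c = false) →
      (∀ c, m < c → applyNet C x c = true) →
      (applyNet P x i = true ↔ ¬ applyNet P x j = true)) :
    ∀ x : Fin n → Bool, applyNet P x i ≤ applyNet P x j := by
  have hI : ∀ S : Finset (Fin n),
      (Finset.univ.filter (fun c => decide (c ∈ S) = true)) = S := by
    intro S; ext; simp
  have := aux_comb (Finset.Ioi m).card (fun S => applyNet P (fun c => decide (c ∈ S)) i = true)
    (fun S => applyNet P (fun c => decide (c ∈ S)) j = true)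
    (fun S T hST => applyNet_mono P _ _ (fun c hc => by simp at hc ⊢; exact hST hc) i)
    (fun S T hST => applyNet_mono P _ _ (fun c hc => by simp at hc ⊢; exact hST hc) j)
    (fun S hS => by
      have h := sorted_out C hC (fun c => decide (c ∈ S)) (Finset.Ioi m)
        (by intro a b hab ha; simp at ha ⊢; exact lt_of_lt_of_le ha hab) (by rw [hI]; exact hS)
      apply H
      · intro c hc
        rw [← Bool.not_eq_true, h]; simpa using hc.le
      · intro c hc
        rw [h]; simpa using hc)
    (fun S hS => by
      have h := sorted_out C hC (fun c => decide (c ∈ S)) (Finset.Ici m)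
        (by intro a b hab ha; simp at ha ⊢; exact le_trans ha hab)
        (by rw [hI, hS, Fin.card_Ioi, Fin.card_Ici]; omega)
      apply H
      · intro c hc
        rw [← Bool.not_eq_true, h]; simpa using hc
      · intro c hc
        rw [h]; simpa using hc.le)
    (Finset.Ioi m) rfl
    (by
      rw [applyNet_sorted P hP]
      · simpa using hmj
      · intro a b hab ha; simp at ha ⊢; exact lt_of_lt_of_le ha hab)
  intro x
  have h := this (Finset.univ.filter (fun c => x c = true))
  have e : (fun c => decide (c ∈ Finset.univ.filter (fun c => x c = true))) = x := by
    funext c; simp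
  rw [e] at h
  exact Bool.le_iff_imp.mpr h

theorem applyNet_append {n : ℕ} (P Q : List (Finset (Fin n × Fin n))) (x : Fin n → Bool) :
    applyNet (P ++ Q) x = applyNet Q (applyNet P x) := by
  simp [applyNet, List.foldl_append]

theorem last_layer {n : ℕ} (P : List (Finset (Fin n × Fin n))) (L : Finset (Fin n × Fin n))
    (hC : SortingNet (P ++ [L])) (a b : Fin n) (hab : (a, b) ∈ L)
    (hN : ¬ ∀ x, applyNet P x a ≤ applyNet P x b) : (a : ℕ) + 1 = b := by
  have hL : ValidLayer L := hC.1 L (by simp)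
  have hlt : a < b := hL.1 _ hab
  by_contra hne
  have hlt' : (a : ℕ) < b := hlt
  apply hN
  apply aux_main (P ++ [L]) P hC (fun K hK => hC.1 K (by simp [hK])) a b ⟨a + 1, by omega⟩
    (by rw [Fin.lt_def]; simp; omega)
  intro x h0 h1
  have e0 := h0 a (by rw [Fin.lt_def]; simp)
  have e1 := h1 b (by rw [Fin.lt_def]; simp; omega)
  rw [applyNet_append] at e0 e1
  change applyLayer L _ _ = _ at e0 e1
  rw [← Bool.not_eq_true, applyLayer_top hL _ hab] at e0
  rw [applyLayer_bot hL _ hab] at e1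
  tauto

theorem block_iff {n : ℕ} (L : Finset (Fin n × Fin n)) (hL : ValidLayer L) (i j : Fin n) :
    Relation.EqvGen (fun i j => ∃ K ∈ [L], (i, j) ∈ K ∨ (j, i) ∈ K) i j ↔
      (i = j ∨ (i, j) ∈ L ∨ (j, i) ∈ L) := by
  constructor
  · intro h
    induction h with
    | rel x y h => simp at h; exact Or.inr h
    | refl x => exact Or.inl rfl
    | symm x y _ ih => rcases ih with h | h | h <;> simp [h]
    | trans x y z _ _ h1 h2 =>
      rcases h1 with rfl | h1 | h1
      · exact h2
      · rcases h2 with rfl | h2 | h2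
        · exact Or.inr (Or.inl h1)
        · exact (vl_lr hL h2 h1).elim
        · exact Or.inl (vl_rr hL h1 h2)
      · rcases h2 with rfl | h2 | h2
        · exact Or.inr (Or.inr h1)
        · exact Or.inl (vl_ll hL h1 h2)
        · exact (vl_lr hL h1 h2).elim
  · rintro (rfl | h)
    · exact .refl _
    · exact .rel _ _ (by simpa using h)

theorem layer_block {n : ℕ} (L : Finset (Fin n × Fin n)) (hL : ValidLayer L) (y : Fin n → Bool)
    (i : Fin n) (v : Bool) (h : ∀ c, (i = c ∨ (i, c) ∈ L ∨ (c, i) ∈ L) → applyLayer L y c = v) :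
    y i = v := by
  have hi := h i (Or.inl rfl)
  by_cases h1 : ∃ b, (i, b) ∈ L
  · obtain ⟨b, hb⟩ := h1
    have hb' := h b (Or.inr (Or.inl hb))
    have e1 := applyLayer_top hL y hb
    have e2 := applyLayer_bot hL y hb
    rw [hi] at e1
    rw [hb'] at e2
    clear h hi hb'
    revert e1 e2
    cases v <;> cases y i <;> cases y b <;> simp
  by_cases h2 : ∃ b, (b, i) ∈ L
  · obtain ⟨b, hb⟩ := h2
    have hb' := h b (Or.inr (Or.inr hb))
    have e1 := applyLayer_top hL y hb
    have e2 := applyLayer_bot hL y hb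
    rw [hb'] at e1
    rw [hi] at e2
    clear h hi hb'
    revert e1 e2
    cases v <;> cases y i <;> cases y b <;> simp
  push Not at h1 h2
  have := applyLayer_none y h1 h2
  rw [hi] at this
  exact (Bool.eq_iff_iff.mpr this).symm

theorem aux_final {n : ℕ} (P : List (Finset (Fin n × Fin n))) (K L : Finset (Fin n × Fin n))
    (hC : SortingNet (P ++ [K, L])) (i j : Fin n) (hp : (i, j) ∈ K)
    (hN1 : ∀ a b, (a, b) ∈ L → ¬ ∀ x, applyNet (P ++ [K]) x a ≤ applyNet (P ++ [K]) x b)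
    (hN2 : ¬ ∀ x, applyNet P x i ≤ applyNet P x j)
    (A B : Finset (Fin n)) (hA : ∀ c, c ∈ A ↔ (i = c ∨ (i, c) ∈ L ∨ (c, i) ∈ L))
    (hB : ∀ c, c ∈ B ↔ (j = c ∨ (j, c) ∈ L ∨ (c, j) ∈ L)) : AdjacentBlocks A B := by
  have hK : ValidLayer K := hC.1 K (by simp)
  have hL : ValidLayer L := hC.1 L (by simp)
  have hij : i < j := hK.1 _ hp
  have hlast : ∀ a b, (a, b) ∈ L → (a : ℕ) + 1 = b := fun a b hab =>
    last_layer (P ++ [K]) L (by simpa using hC) a b hab (hN1 a b hab)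
  have hijL : (i, j) ∉ L := by
    intro h
    apply hN1 i j h
    intro x
    rw [applyNet_append, Bool.le_iff_imp]
    change applyLayer K _ _ = true → applyLayer K _ _ = true
    rw [applyLayer_top hK _ hp, applyLayer_bot hK _ hp]
    tauto
  have hiA : i ∈ A := (hA i).mpr (Or.inl rfl)
  have hjB : j ∈ B := (hB j).mpr (Or.inl rfl)
  have hjA : j ∉ A := by
    rw [hA]
    rintro (h | h | h)
    · exact hij.ne h
    · exact hijL h
    · exact lt_asymm hij (hL.1 _ h)
  have hlt : ∀ a ∈ A, ∀ b ∈ B, (a : ℕ) < b := by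
    intro a ha b hb
    rw [hA] at ha
    rw [hB] at hb
    have hij' : (i : ℕ) < j := hij
    have hne : ∀ u w : Fin n, u ≠ w → (u : ℕ) ≠ w := fun u w h e => h (Fin.ext e)
    rcases ha with rfl | ha | ha <;> rcases hb with rfl | hb | hb
    · exact hij'
    · have := hlast _ _ hb; omega
    · have h1 := hlast _ _ hb
      have := hne i b (by rintro rfl; exact hijL hb)
      omega
    · have h1 := hlast _ _ ha
      have := hne a j (by rintro rfl; exact hijL ha)
      omega
    · have h1 := hlast _ _ hb
      have h2 := hlast _ _ ha
      omega
    · have h1 := hlast _ _ hb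
      have h2 := hlast _ _ ha
      have := hne a b (by rintro rfl; exact vl_lr hL hb ha)
      have := hne a j (by rintro rfl; exact hijL ha)
      omega
    · have := hlast _ _ ha; omega
    · have h1 := hlast _ _ hb
      have h2 := hlast _ _ ha
      omega
    · have h1 := hlast _ _ hb
      have h2 := hlast _ _ ha
      omega
  refine ⟨fun e => hjA (e ▸ hjB), ⟨i, hiA⟩, ⟨j, hjB⟩, Or.inl ?_⟩
  by_contra hne
  have hM := hlt _ (A.max'_mem ⟨i, hiA⟩) _ (B.min'_mem ⟨j, hjB⟩)
  have hAle : ∀ a ∈ A, (a : ℕ) ≤ A.max' ⟨i, hiA⟩ := fun a ha => A.le_max' a ha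
  have hBle : ∀ b ∈ B, (B.min' ⟨j, hjB⟩ : ℕ) ≤ b := fun b hb => B.min'_le b hb
  have hBj := hBle j hjB
  generalize A.max' ⟨i, hiA⟩ = u at *
  generalize B.min' ⟨j, hjB⟩ = w at *
  apply hN2
  apply aux_main (P ++ [K, L]) P hC (fun Q hQ => hC.1 Q (by simp [hQ])) i j ⟨u + 1, by omega⟩
    (by rw [Fin.lt_def]; simp; omega)
  intro x h0 h1
  rw [applyNet_append] at h0 h1
  change ∀ c, _ → applyLayer L (applyLayer K (applyNet P x)) c = _ at h0 h1
  have e0 := layer_block L hL _ i false (fun c hc => h0 c (by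
    have := hAle c ((hA c).mpr hc)
    rw [Fin.lt_def]; simp; omega))
  have e1 := layer_block L hL _ j true (fun c hc => h1 c (by
    have := hBle c ((hB c).mpr hc)
    rw [Fin.lt_def]; simp; omega))
  rw [← Bool.not_eq_true, applyLayer_top hK _ hp] at e0
  rw [applyLayer_bot hK _ hp] at e1
  tauto


/-- in a non-redundant sorting network of depth `d`, every comparator of the
penultimate layer `L_{d-1}` (0-based index `d - 2`) connects two distinct adjacent
`(d-1)`-blocks. -/
theorem penultimate_layer_connects_adjacent_blocks {n d : ℕ}
    (C : List (Finset (Fin n × Fin n))) (hd : C.length = d) (hd2 : 2 ≤ d)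
    (hC : SortingNet C) (hNR : NonRedundant C)
    (p : Fin n × Fin n) (hp : p ∈ C.getD (d - 2) ∅) :
    ∃ A B : Finset (Fin n), IsBlock C (d - 1) A ∧ IsBlock C (d - 1) B ∧
      p.1 ∈ A ∧ p.2 ∈ B ∧ AdjacentBlocks A B := by
  classical
  obtain ⟨P, K, L, rfl⟩ : ∃ P K L, C = P ++ [K, L] := by
    rcases List.eq_nil_or_concat C with rfl | ⟨C', L, rfl⟩
    · simp at hd; omega
    rcases List.eq_nil_or_concat C' with rfl | ⟨P, K, rfl⟩
    · simp at hd; omega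
    exact ⟨P, K, L, by simp⟩
  have hd' : d = P.length + 2 := by simpa using hd.symm
  subst hd'
  obtain ⟨i, j⟩ := p
  have e1 : (P ++ [K, L]).drop (P.length + 2 - 1) = [L] := by
    simp [List.drop_append]
  have hL : ValidLayer L := hC.1 L (by simp)
  have hpK : (i, j) ∈ K := by simpa using hp
  have hb : ∀ a b, blockRel (P ++ [K, L]) (P.length + 2 - 1) a b ↔
      (a = b ∨ (a, b) ∈ L ∨ (b, a) ∈ L) := by
    intro a b
    unfold blockRel
    rw [e1]
    exact block_iff L hL a b
  refine ⟨Finset.univ.filter (fun c => i = c ∨ (i, c) ∈ L ∨ (c, i) ∈ L),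
    Finset.univ.filter (fun c => j = c ∨ (j, c) ∈ L ∨ (c, j) ∈ L),
    ⟨i, fun c => by rw [hb]; simp⟩, ⟨j, fun c => by rw [hb]; simp⟩, by simp, by simp, ?_⟩
  refine aux_final P K L hC i j hpK ?_ ?_ _ _ (by simp) (by simp)
  · intro a b hab
    have := hNR (P.length + 1) (a, b) (by simpa [List.getD_append_right] using hab)
    have e2 : (P ++ [K, L]).take (P.length + 1) = P ++ [K] := by
      simp [List.take_append, List.take_of_length_le]
    unfold Redundant at this
    rw [e2] at this
    exact this
  · have := hNR P.length (i, j) (by simpa using hpK)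
    simpa [Redundant] using this
end

section
/- For every n ≥ 1, the number of layers on n channels all of whose comparators are of the form (i,i+1) and in which no two adjacent channels are both unused equals P_{n+5}, where P denotes the Padovan sequence defined by P_0 = 1, P_1 = P_2 = 0 and P_{m+3} = P_m + P_{m+1}. -/
/-- The Padovan sequence with `P 0 = 1`, `P 1 = P 2 = 0`, `P (m+3) = P m + P (m+1)`. -/
def padovan : ℕ → ℕ
  | 0 => 1
  | 1 => 0
  | 2 => 0
  | (m + 3) => padovan m + padovan (m + 1)

/-- Combinatorial encoding by left endpoints. -/
def GoodS (n : ℕ) (S : Finset ℕ) : Prop :=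
  (∀ i ∈ S, i + 1 < n ∧ i + 1 ∉ S) ∧
  ∀ i, i + 1 < n → i ∈ S ∨ i + 1 ∈ S ∨ ∃ j ∈ S, j + 1 = i

theorem goodS_step_a (n : ℕ) (S : Finset ℕ) (h : GoodS (n + 3) S) (h1 : n + 1 ∈ S) :
    GoodS (n + 1) (S.erase (n + 1)) := by
  obtain ⟨ha, hb⟩ := h
  refine ⟨fun i hi => ?_, fun i hi => ?_⟩
  · grind
  · rcases hb i (by omega) with h | h | ⟨j, h, e⟩
    · exact Or.inl (Finset.mem_erase.2 ⟨by omega, h⟩)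
    · exact Or.inr (Or.inl (Finset.mem_erase.2 ⟨by omega, h⟩))
    · exact Or.inr (Or.inr ⟨j, Finset.mem_erase.2 ⟨by omega, h⟩, e⟩)

theorem goodS_step_b (n : ℕ) (S : Finset ℕ) (h : GoodS (n + 3) S) (h1 : n + 1 ∉ S) :
    n ∈ S ∧ GoodS n (S.erase n) := by
  obtain ⟨ha, hb⟩ := h
  have hn : n ∈ S := by
    have := hb (n + 1) (by omega)
    grind
  refine ⟨hn, fun i hi => ?_, fun i hi => ?_⟩
  · grind
  · rcases hb i (by omega) with h | h | ⟨j, h, e⟩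
    · exact Or.inl (Finset.mem_erase.2 ⟨by omega, h⟩)
    · exact Or.inr (Or.inl (Finset.mem_erase.2 ⟨by omega, h⟩))
    · exact Or.inr (Or.inr ⟨j, Finset.mem_erase.2 ⟨by omega, h⟩, e⟩)

theorem goodS_ins_a (n : ℕ) (S : Finset ℕ) (h : GoodS (n + 1) S) :
    GoodS (n + 3) (insert (n + 1) S) := by
  obtain ⟨ha, hb⟩ := h
  refine ⟨fun i hi => ?_, fun i hi => ?_⟩
  · grind
  · rcases (by omega : i + 1 < n + 1 ∨ i = n ∨ i = n + 1) with h | h | h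
    · rcases hb i h with h | h | ⟨j, h, e⟩
      · exact Or.inl (Finset.mem_insert_of_mem h)
      · exact Or.inr (Or.inl (Finset.mem_insert_of_mem h))
      · exact Or.inr (Or.inr ⟨j, Finset.mem_insert_of_mem h, e⟩)
    · grind
    · grind

theorem goodS_ins_b (n : ℕ) (S : Finset ℕ) (h : GoodS n S) :
    GoodS (n + 3) (insert n S) := by
  obtain ⟨ha, hb⟩ := h
  refine ⟨fun i hi => ?_, fun i hi => ?_⟩
  · grind
  · rcases (by omega : i + 1 < n ∨ i + 1 = n ∨ i = n ∨ i = n + 1) with h | h | h | h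
    · rcases hb i h with h | h | ⟨j, h, e⟩
      · exact Or.inl (Finset.mem_insert_of_mem h)
      · exact Or.inr (Or.inl (Finset.mem_insert_of_mem h))
      · exact Or.inr (Or.inr ⟨j, Finset.mem_insert_of_mem h, e⟩)
    · grind
    · grind
    · exact Or.inr (Or.inr ⟨n, Finset.mem_insert_self _ _, h.symm⟩)

/-- Recursive enumeration. -/
def famS : ℕ → Finset (Finset ℕ)
  | 0 => {∅}
  | 1 => {∅}
  | 2 => {{0}}
  | (n + 3) => (famS (n + 1)).image (insert (n + 1)) ∪ (famS n).image (insert n)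

theorem mem_famS (n : ℕ) : ∀ S, S ∈ famS n ↔ GoodS n S := by
  induction n using famS.induct with
  | case1 =>
    intro S
    simp only [famS, Finset.mem_singleton, GoodS]
    constructor
    · rintro rfl; simp
    · rintro ⟨h, -⟩
      ext i; have := h i; grind
  | case2 =>
    intro S
    simp only [famS, Finset.mem_singleton, GoodS]
    constructor
    · rintro rfl; simp
    · rintro ⟨h, -⟩
      ext i; have := h i; grind
  | case3 =>
    intro S
    simp only [famS, Finset.mem_singleton, GoodS]
    constructor
    · rintro rfl; simp
    · rintro ⟨h, h'⟩
      have := h' 0 (by omega)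
      ext i; have := h i; have := h 1; grind
  | case4 n ih1 ih2 =>
    intro S
    simp only [famS, Finset.mem_union, Finset.mem_image]
    constructor
    · rintro (⟨T, hT, rfl⟩ | ⟨T, hT, rfl⟩)
      · exact goodS_ins_a n T (by grind)
      · exact goodS_ins_b n T (by grind)
    · intro h
      by_cases h1 : n + 1 ∈ S
      · have := goodS_step_a n S h h1
        exact Or.inl ⟨_, by grind, Finset.insert_erase h1⟩
      · have := goodS_step_b n S h h1
        exact Or.inr ⟨_, by grind, Finset.insert_erase this.1⟩

theorem card_famS (n : ℕ) : (famS n).card = padovan (n + 5) := by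
  induction n using famS.induct with
  | case1 => simp [famS, padovan]
  | case2 => simp [famS, padovan]
  | case3 => simp [famS, padovan]
  | case4 n ih1 ih2 =>
    have e : padovan (n + 3 + 5) = padovan (n + 5) + padovan (n + 1 + 5) := by
      rw [show n + 3 + 5 = (n + 5) + 3 by ring, padovan]
    have hlt : ∀ m, ∀ T ∈ famS m, ∀ i ∈ T, i + 1 < m := fun m T hT i hi =>
      (((mem_famS m T).1 hT).1 i hi).1
    rw [famS, Finset.card_union_of_disjoint, Finset.card_image_of_injOn,
      Finset.card_image_of_injOn, e]
    · grind
    · intro A hA B hB hAB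
      have a := hlt _ A hA n
      have b := hlt _ B hB n
      rw [← Finset.erase_insert (a := n) (s := A) (by grind),
        ← Finset.erase_insert (a := n) (s := B) (by grind)]
      exact congrArg (fun X => Finset.erase X n) hAB
    · intro A hA B hB hAB
      have a := hlt _ A hA (n + 1)
      have b := hlt _ B hB (n + 1)
      rw [← Finset.erase_insert (a := n + 1) (s := A) (by grind),
        ← Finset.erase_insert (a := n + 1) (s := B) (by grind)]
      exact congrArg (fun X => Finset.erase X (n + 1)) hAB
    · rw [Finset.disjoint_left]
      intro S hS hS'
      simp only [Finset.mem_image] at hS hS'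
      obtain ⟨A, hA, rfl⟩ := hS
      obtain ⟨B, hB, h⟩ := hS'
      have b := hlt _ B hB (n + 1)
      have : n + 1 ∈ insert n B := by rw [h]; simp
      grind

/-- A layer with its left endpoints forgotten or recovered. -/
def layerOf (n : ℕ) (S : Finset ℕ) : Finset (Fin n × Fin n) :=
  Finset.univ.filter fun p => (p.1 : ℕ) ∈ S ∧ (p.2 : ℕ) = (p.1 : ℕ) + 1

/-- Left endpoints. -/
def startsOf {n : ℕ} (L : Finset (Fin n × Fin n)) : Finset ℕ := L.image fun p => (p.1 : ℕ)

theorem mem_startsOf {n : ℕ} (L : Finset (Fin n × Fin n)) (i : ℕ) :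
    i ∈ startsOf L ↔ ∃ p ∈ L, (p.1 : ℕ) = i := by simp [startsOf]

theorem mem_layerOf {n : ℕ} (S : Finset ℕ) (p : Fin n × Fin n) :
    p ∈ layerOf n S ↔ (p.1 : ℕ) ∈ S ∧ (p.2 : ℕ) = (p.1 : ℕ) + 1 := by simp [layerOf]

/-- The property in the statement. -/
def LProp {n : ℕ} (L : Finset (Fin n × Fin n)) : Prop :=
  ValidLayer L ∧ (∀ p ∈ L, (p.2 : ℕ) = (p.1 : ℕ) + 1) ∧
    (∀ i j : Fin n, (j : ℕ) = (i : ℕ) + 1 → UsedIn i L ∨ UsedIn j L)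

theorem good_startsOf {n : ℕ} (L : Finset (Fin n × Fin n)) (h : LProp L) :
    GoodS n (startsOf L) := by
  obtain ⟨⟨h0, h1⟩, h2, h3⟩ := h
  refine ⟨fun i hi => ?_, fun i hi => ?_⟩
  · obtain ⟨p, hp, rfl⟩ := (mem_startsOf _ _).1 hi
    have e := h2 p hp
    refine ⟨by omega, fun hc => ?_⟩
    obtain ⟨q, hq, hqe⟩ := (mem_startsOf _ _).1 hc
    have hne : p ≠ q := by rintro rfl; omega
    exact (h1 p hp q hq hne).2.2.1 (Fin.ext (by omega))
  · simp only [mem_startsOf]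
    rcases h3 ⟨i, by omega⟩ ⟨i + 1, hi⟩ rfl with ⟨q, hq, h | h⟩ | ⟨q, hq, h | h⟩
    · exact Or.inl ⟨q, hq, by simp [h]⟩
    · have := h2 q hq
      exact Or.inr (Or.inr ⟨_, ⟨q, hq, rfl⟩, by rw [← this, h]⟩)
    · exact Or.inr (Or.inl ⟨q, hq, by simp [h]⟩)
    · have := h2 q hq
      rw [h] at this
      simp only at this
      exact Or.inl ⟨q, hq, by omega⟩

theorem lprop_layerOf {n : ℕ} (S : Finset ℕ) (h : GoodS n S) : LProp (layerOf n S) := by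
  obtain ⟨ha, hb⟩ := h
  refine ⟨⟨fun p hp => ?_, fun p hp q hq hpq => ?_⟩, fun p hp => ?_, fun i j hij => ?_⟩
  · rw [mem_layerOf] at hp
    rw [Fin.lt_def]; omega
  · rw [mem_layerOf] at hp hq
    have a := ha _ hp.1
    have b := ha _ hq.1
    have hne : (p.1 : ℕ) ≠ q.1 := by
      intro e
      exact hpq (Prod.ext (Fin.ext e) (Fin.ext (by omega)))
    simp only [ne_eq, Fin.ext_iff]
    refine ⟨hne, fun e => ?_, fun e => ?_, fun e => ?_⟩
    · apply b.2; rw [← hq.2, ← e]; exact hp.1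
    · apply a.2; rw [← hp.2, e]; exact hq.1
    · omega
  · exact ((mem_layerOf _ _).1 hp).2
  · rcases hb i (by omega) with h | h | ⟨k, h, e⟩
    · exact Or.inl ⟨(i, j), (mem_layerOf _ _).2 ⟨h, hij⟩, Or.inl rfl⟩
    · have := ha _ h
      refine Or.inr ⟨(j, ⟨j + 1, by omega⟩), (mem_layerOf _ _).2 ⟨?_, rfl⟩, Or.inl rfl⟩
      simpa [hij] using h
    · exact Or.inl ⟨(⟨k, by omega⟩, i), (mem_layerOf _ _).2 ⟨h, e.symm⟩, Or.inr rfl⟩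

theorem layerOf_startsOf {n : ℕ} (L : Finset (Fin n × Fin n)) (h : LProp L) :
    layerOf n (startsOf L) = L := by
  ext p
  rw [mem_layerOf, mem_startsOf]
  constructor
  · rintro ⟨⟨q, hq, e⟩, e'⟩
    have := h.2.1 q hq
    have : q = p := Prod.ext (Fin.ext e) (Fin.ext (by omega))
    exact this ▸ hq
  · intro hp
    exact ⟨⟨p, hp, rfl⟩, h.2.1 p hp⟩

theorem startsOf_layerOf {n : ℕ} (S : Finset ℕ) (h : GoodS n S) :
    startsOf (layerOf n S) = S := by
  ext i
  rw [mem_startsOf]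
  constructor
  · rintro ⟨p, hp, rfl⟩
    exact ((mem_layerOf _ _).1 hp).1
  · intro hi
    have := (h.1 i hi).1
    exact ⟨(⟨i, by omega⟩, ⟨i + 1, this⟩), (mem_layerOf _ _).2 ⟨hi, rfl⟩, rfl⟩

/-- The bijection. -/
def layerEquiv (n : ℕ) : {L : Finset (Fin n × Fin n) // LProp L} ≃ famS n where
  toFun L := ⟨startsOf L.1, (mem_famS _ _).2 (good_startsOf L.1 L.2)⟩
  invFun S := ⟨layerOf n S.1, lprop_layerOf S.1 ((mem_famS _ _).1 S.2)⟩
  left_inv L := Subtype.ext (layerOf_startsOf L.1 L.2)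
  right_inv S := Subtype.ext (startsOf_layerOf S.1 ((mem_famS _ _).1 S.2))

/-- the number of layers on `n` channels all of whose comparators connect
adjacent channels and in which no two adjacent channels are both unused equals `P_{n+5}`. -/
theorem count_llnf_last_layers {n : ℕ} (hn : 1 ≤ n) :
    Nat.card {L : Finset (Fin n × Fin n) //
        ValidLayer L ∧ (∀ p ∈ L, (p.2 : ℕ) = (p.1 : ℕ) + 1) ∧
        (∀ i j : Fin n, (j : ℕ) = (i : ℕ) + 1 → UsedIn i L ∨ UsedIn j L)} =
      padovan (n + 5) := by
  refine (Nat.card_congr (layerEquiv n)).trans ?_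
  rw [← card_famS]
  simp
end

section
/- Let C be a sorting network of depth d on n channels in last layer normal form. Let i < j be two channels that are both unused in layer d−1 of C and that belong to two different blocks of C. Then the comparator network obtained from C by adding the comparator (i,j) to layer d−1 is still a sorting network. -/
/-- A network of depth `d ≥ 1` is in last layer normal form: every comparator of the last
layer is of the form `(i,i+1)`, and no two adjacent channels are both unused in the last
layer. -/
def LLNF {n : ℕ} (C : List (Finset (Fin n × Fin n))) : Prop :=
  (∀ p ∈ C.getD (C.length - 1) ∅, (p.2 : ℕ) = (p.1 : ℕ) + 1) ∧
  (∀ i j : Fin n, (j : ℕ) = (i : ℕ) + 1 →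
    UsedIn i (C.getD (C.length - 1) ∅) ∨ UsedIn j (C.getD (C.length - 1) ∅))

theorem aux_up {n : ℕ} (B : Finset (Fin n × Fin n)) (z : Fin n → Bool) (i : Fin n)
    (h : z i = true) : ∃ i', (i' = i ∨ (i, i') ∈ B) ∧ applyLayer B z i' = true := by
  by_cases hk : ∃ k, (i, k) ∈ B
  · obtain ⟨k, hk⟩ := hk
    refine ⟨k, Or.inr hk, ?_⟩
    simp only [applyLayer, Bool.or_eq_true, decide_eq_true_eq]
    exact Or.inr ⟨i, hk, h⟩
  · refine ⟨i, Or.inl rfl, ?_⟩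
    simp only [applyLayer, Bool.or_eq_true, Bool.and_eq_true, decide_eq_true_eq]
    exact Or.inl ⟨h, fun j hj => absurd ⟨j, hj⟩ hk⟩

theorem aux_down {n : ℕ} (B : Finset (Fin n × Fin n)) (hB : ValidLayer B)
    (z : Fin n → Bool) (j : Fin n)
    (h : z j = false) : ∃ j', (j' = j ∨ (j', j) ∈ B) ∧ ¬ applyLayer B z j' = true := by
  by_cases hk : ∃ k, (k, j) ∈ B
  · obtain ⟨k, hk⟩ := hk
    refine ⟨k, Or.inr hk, ?_⟩
    simp only [applyLayer, Bool.or_eq_true, Bool.and_eq_true, decide_eq_true_eq]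
    rintro (⟨_, h2⟩ | ⟨l, hl, _⟩)
    · have := h2 j hk
      simp [h] at this
    · have hne : (l, k) ≠ (k, j) := by
        intro e
        have h1 := hB.1 _ hk
        simp only [Prod.mk.injEq] at e
        simp [e.2] at h1
      exact (hB.2 _ hl _ hk hne).2.2.1 rfl
  · refine ⟨j, Or.inl rfl, ?_⟩
    simp only [applyLayer, Bool.or_eq_true, Bool.and_eq_true, decide_eq_true_eq]
    rintro (⟨h1, _⟩ | ⟨l, hl, _⟩)
    · simp [h] at h1
    · exact hk ⟨l, hl⟩

theorem aux_unused {n : ℕ} (A : Finset (Fin n × Fin n)) (y : Fin n → Bool) (i : Fin n)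
    (hi : ¬ UsedIn i A) : applyLayer A y i = y i := by
  have h1 : ∀ k, (i, k) ∉ A := fun k hk => hi ⟨_, hk, Or.inl rfl⟩
  have h2 : ∀ k, (k, i) ∉ A := fun k hk => hi ⟨_, hk, Or.inr rfl⟩
  simp [applyLayer, h1, h2]

theorem aux_insert {n : ℕ} (A : Finset (Fin n × Fin n)) (y : Fin n → Bool) (i j : Fin n)
    (hj : ¬ UsedIn j A) (h : y i = true → y j = true) :
    applyLayer (insert (i, j) A) y = applyLayer A y := by
  funext c
  rw [Bool.eq_iff_iff]
  simp only [applyLayer, Bool.or_eq_true, Bool.and_eq_true, decide_eq_true_eq,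
    Finset.mem_insert, Prod.mk.injEq]
  constructor
  · rintro (⟨h1, h2⟩ | ⟨k, ⟨rfl, rfl⟩ | hk, hy⟩)
    · exact Or.inl ⟨h1, fun k hk => h2 k (Or.inr hk)⟩
    · exact Or.inl ⟨h hy, fun l hl => absurd ⟨_, hl, Or.inl rfl⟩ hj⟩
    · exact Or.inr ⟨k, hk, hy⟩
  · rintro (⟨h1, h2⟩ | ⟨k, hk, hy⟩)
    · refine Or.inl ⟨h1, ?_⟩
      rintro k (⟨rfl, rfl⟩ | hk)
      · exact h h1
      · exact h2 k hk
    · exact Or.inr ⟨k, Or.inr hk, hy⟩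

theorem aux_valid {n : ℕ} (A : Finset (Fin n × Fin n)) (hA : ValidLayer A) (i j : Fin n)
    (hij : i < j) (hi : ¬ UsedIn i A) (hj : ¬ UsedIn j A) :
    ValidLayer (insert (i, j) A) := by
  have key : ∀ p ∈ A, p.1 ≠ i ∧ p.2 ≠ i ∧ p.1 ≠ j ∧ p.2 ≠ j := fun p hp =>
    ⟨fun e => hi ⟨p, hp, Or.inl e⟩, fun e => hi ⟨p, hp, Or.inr e⟩,
      fun e => hj ⟨p, hp, Or.inl e⟩, fun e => hj ⟨p, hp, Or.inr e⟩⟩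
  constructor
  · intro p hp
    rcases Finset.mem_insert.1 hp with rfl | hp
    · exact hij
    · exact hA.1 p hp
  · intro p hp q hq hpq
    rcases Finset.mem_insert.1 hp with rfl | hp <;> rcases Finset.mem_insert.1 hq with rfl | hq
    · exact absurd rfl hpq
    · obtain ⟨a, b, c, d⟩ := key q hq
      exact ⟨a.symm, b.symm, c.symm, d.symm⟩
    · obtain ⟨a, b, c, d⟩ := key p hp
      exact ⟨a, c, b, d⟩
    · exact hA.2 p hp q hq hpq

theorem aux_decomp {α : Type*} (C : List α) (h : 2 ≤ C.length) :
    ∃ P A B, C = P ++ [A, B] := by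
  rcases List.eq_nil_or_concat C with rfl | ⟨D, B, rfl⟩
  · simp at h
  · rcases List.eq_nil_or_concat D with rfl | ⟨P, A, rfl⟩
    · simp at h
    · exact ⟨P, A, B, by simp⟩

/-- let `C` be a sorting network of depth `d` in llnf, and let `i < j` be
channels unused in layer `d-1` (0-based index `d - 2`) lying in different blocks (different
`(d-1)`-blocks, i.e. the classes generated by the comparators of the last layer). Then
adding the comparator `(i,j)` to layer `d-1` still yields a sorting network. -/
theorem add_redundant_comparator_penultimate {n d : ℕ}
    (C : List (Finset (Fin n × Fin n))) (hd : C.length = d) (hd2 : 2 ≤ d)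
    (hC : SortingNet C) (hllnf : LLNF C)
    (i j : Fin n) (hij : i < j)
    (hi : ¬ UsedIn i (C.getD (d - 2) ∅)) (hj : ¬ UsedIn j (C.getD (d - 2) ∅))
    (hblocks : ¬ blockRel C (d - 1) i j) :
    SortingNet (C.set (d - 2) (insert (i, j) (C.getD (d - 2) ∅))) := by
  obtain ⟨P, A, B, rfl⟩ := aux_decomp C (hd ▸ hd2)
  have hlen : d = P.length + 2 := by simp at hd; omega
  subst hlen
  have e1 : (P ++ [A, B]).getD (P.length + 2 - 2) ∅ = A := by simp
  have e2 : (P ++ [A, B]).getD ((P ++ [A, B]).length - 1) ∅ = B := by simp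
  have e3 : (P ++ [A, B]).set (P.length + 2 - 2) (insert (i, j) A)
      = P ++ [insert (i, j) A, B] := by simp
  have e4 : (P ++ [A, B]).drop (P.length + 2 - 1) = [B] := by
    simp [List.drop_append]
  rw [e1] at hi hj ⊢
  rw [e3]
  have hAd := hllnf.1
  rw [e2] at hAd
  have hnB : (i, j) ∉ B := fun hm => hblocks (Relation.EqvGen.rel _ _
    ⟨B, by rw [e4]; simp, Or.inl hm⟩)
  have hvA : ValidLayer A := hC.1 A (by simp)
  have hvB : ValidLayer B := hC.1 B (by simp)
  refine ⟨?_, ?_⟩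
  · intro L hL
    simp only [List.mem_append, List.mem_cons, List.not_mem_nil, or_false] at hL
    rcases hL with hL | rfl | rfl
    · exact hC.1 L (by simp [hL])
    · exact aux_valid A hvA i j hij hi hj
    · exact hvB
  · intro x
    have hs := hC.2 x
    simp only [applyNet, List.foldl_append, List.foldl_cons, List.foldl_nil] at hs ⊢
    set y := List.foldl (fun v L => applyLayer L v) x P
    rw [aux_insert A y i j hj]
    · exact hs
    intro hyi
    by_contra hyj
    rw [← aux_unused A y i hi] at hyi
    rw [← aux_unused A y j hj, Bool.not_eq_true] at hyj
    obtain ⟨i', hi', hti⟩ := aux_up B _ i hyi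
    obtain ⟨j', hj', htj⟩ := aux_down B hvB _ j hyj
    have hle : i' ≤ j' := by
      rw [Fin.le_def]
      rw [Fin.lt_def] at hij
      rcases hi' with rfl | hi' <;> rcases hj' with rfl | hj'
      · omega
      · have := hAd _ hj'
        simp only at this
        omega
      · have := hAd _ hi'
        simp only at this
        omega
      · have h1 := hAd _ hi'
        have h2 := hAd _ hj'
        simp only at h1 h2
        have : i' ≠ j := by
          rintro rfl
          exact hnB hi'
        have : (i' : ℕ) ≠ j := fun e => this (Fin.ext e)
        omega
    have := hs i' j' hle
    rw [hti] at this
    exact htj (this rfl)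
end

section
/- Let C be a sorting network of depth d on n channels in last layer normal form. Suppose that the last layer L_d contains a comparator (i,i+1), that channel i+2 is used in layer d−1 but not in layer d, and that channels i and i+1 are both unused in layer d−1. Then there exists a sorting network C' of depth d on n channels in last layer normal form such that channels i+1 and i+2 are both used in layer d−1 of C' and both used in layer d of C'. -/
theorem aux_unused_s11 {n : ℕ} (L : Finset (Fin n × Fin n)) (x : Fin n → Bool) (c : Fin n)
    (h : ¬ UsedIn c L) : applyLayer L x c = x c := by
  have h1 : ∀ j, (c, j) ∉ L := fun j hj => h ⟨_, hj, Or.inl rfl⟩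
  have h2 : ∀ j, (j, c) ∉ L := fun j hj => h ⟨_, hj, Or.inr rfl⟩
  simp [applyLayer, h1, h2]

theorem aux_union {n : ℕ} (L M : Finset (Fin n × Fin n)) (x : Fin n → Bool)
    (h : ∀ c, UsedIn c M → ¬ UsedIn c L) :
    applyLayer (L ∪ M) x = applyLayer M (applyLayer L x) := by
  funext c
  by_cases hc : UsedIn c M
  · have hL := h c hc
    have h1 : ∀ j, (c, j) ∉ L := fun j hj => hL ⟨_, hj, Or.inl rfl⟩
    have h2 : ∀ j, (j, c) ∉ L := fun j hj => hL ⟨_, hj, Or.inr rfl⟩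
    have e0 := aux_unused_s11 L x c hL
    have e1 : ∀ j, (c, j) ∈ M → applyLayer L x j = x j :=
      fun j hj => aux_unused_s11 L x j (h j ⟨_, hj, Or.inr rfl⟩)
    have e2 : ∀ j, (j, c) ∈ M → applyLayer L x j = x j :=
      fun j hj => aux_unused_s11 L x j (h j ⟨_, hj, Or.inl rfl⟩)
    have p1 : (∀ j, (c, j) ∈ L ∪ M → x j = true) ↔
        (∀ j, (c, j) ∈ M → applyLayer L x j = true) := by
      constructor
      · intro H j hj
        rw [e1 j hj]
        exact H j (Finset.mem_union_right _ hj)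
      · intro H j hj
        rcases Finset.mem_union.1 hj with hj | hj
        · exact absurd hj (h1 j)
        · rw [← e1 j hj]; exact H j hj
    have p2 : (∃ j, (j, c) ∈ L ∪ M ∧ x j = true) ↔
        (∃ j, (j, c) ∈ M ∧ applyLayer L x j = true) := by
      constructor
      · rintro ⟨j, hj, hx⟩
        rcases Finset.mem_union.1 hj with hj | hj
        · exact absurd hj (h2 j)
        · exact ⟨j, hj, by rw [e2 j hj]; exact hx⟩
      · rintro ⟨j, hj, hx⟩
        exact ⟨j, Finset.mem_union_right _ hj, by rw [← e2 j hj]; exact hx⟩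
    calc applyLayer (L ∪ M) x c
        = ((x c && decide (∀ j, (c, j) ∈ L ∪ M → x j = true)) ||
           decide (∃ i, (i, c) ∈ L ∪ M ∧ x i = true)) := rfl
      _ = ((applyLayer L x c && decide (∀ j, (c, j) ∈ M → applyLayer L x j = true)) ||
           decide (∃ i, (i, c) ∈ M ∧ applyLayer L x i = true)) := by
          rw [e0, decide_eq_decide.2 p1, decide_eq_decide.2 p2]
      _ = _ := rfl
  · rw [aux_unused_s11 M _ c hc]
    have h1 : ∀ j, (c, j) ∉ M := fun j hj => hc ⟨_, hj, Or.inl rfl⟩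
    have h2 : ∀ j, (j, c) ∉ M := fun j hj => hc ⟨_, hj, Or.inr rfl⟩
    simp [applyLayer, h1, h2]

theorem aux_sorted {n : ℕ} (L : Finset (Fin n × Fin n)) (x : Fin n → Bool)
    (hL : ∀ p ∈ L, p.1 < p.2) (hx : SortedVec x) : applyLayer L x = x := by
  funext c
  have h1 : x c = true → ∀ j, (c, j) ∈ L → x j = true := by
    intro h j hj
    have := hx c j (hL _ hj).le
    rw [h] at this
    exact top_le_iff.1 this
  have h2 : (∃ i, (i, c) ∈ L ∧ x i = true) → x c = true := by
    rintro ⟨j, hj, h⟩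
    have := hx j c (hL _ hj).le
    rw [h] at this
    exact top_le_iff.1 this
  unfold applyLayer
  cases hc : x c
  · simp only [Bool.false_and, Bool.false_or, decide_eq_false_iff_not]
    intro h
    simp [h2 h] at hc
  · simp only [Bool.true_and, Bool.or_eq_true, decide_eq_true_eq]
    exact Or.inl (h1 hc)

theorem aux_valid_union {n : ℕ} (L M : Finset (Fin n × Fin n)) (hL : ValidLayer L)
    (hM : ValidLayer M) (h : ∀ c, UsedIn c M → ¬ UsedIn c L) : ValidLayer (L ∪ M) := by
  have key : ∀ p ∈ L, ∀ q ∈ M, p.1 ≠ q.1 ∧ p.1 ≠ q.2 ∧ p.2 ≠ q.1 ∧ p.2 ≠ q.2 := by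
    intro p hp q hq
    have a := h q.1 ⟨q, hq, Or.inl rfl⟩
    have b := h q.2 ⟨q, hq, Or.inr rfl⟩
    exact ⟨fun e => a ⟨p, hp, Or.inl e⟩, fun e => b ⟨p, hp, Or.inl e⟩,
      fun e => a ⟨p, hp, Or.inr e⟩, fun e => b ⟨p, hp, Or.inr e⟩⟩
  refine ⟨?_, ?_⟩
  · intro p hp
    rcases Finset.mem_union.1 hp with hp | hp
    exacts [hL.1 p hp, hM.1 p hp]
  · intro p hp q hq hpq
    rcases Finset.mem_union.1 hp with hp | hp <;> rcases Finset.mem_union.1 hq with hq | hq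
    · exact hL.2 p hp q hq hpq
    · exact key p hp q hq
    · obtain ⟨a, b, c, d⟩ := key q hq p hp
      exact ⟨a.symm, c.symm, b.symm, d.symm⟩
    · exact hM.2 p hp q hq hpq

theorem aux_split {α : Type*} (C : List α) (h : 2 ≤ C.length) :
    ∃ (P : List α) (A B : α), C = P ++ [A, B] := by
  have hr : C = C.reverse.reverse := by simp
  match hC : C.reverse with
  | [] => rw [hC] at hr; subst hr; simp at h
  | [a] => rw [hC] at hr; subst hr; simp at h
  | b :: a :: t => exact ⟨t.reverse, a, b, by rw [hr, hC]; simp⟩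

/-- let `C` be a sorting network of depth `d` in llnf with a comparator
`(i, i+1)` in its last layer, such that channel `i+2` is used in layer `d-1` but not in
layer `d`, and channels `i` and `i+1` are unused in layer `d-1`. Then there is a sorting
network `C'` of depth `d` in llnf in which channels `i+1` and `i+2` are used both in
layer `d-1` and in layer `d`. -/
theorem move_comparator_forward {n d : ℕ}
    (C : List (Finset (Fin n × Fin n))) (hd : C.length = d) (hd2 : 2 ≤ d)
    (hC : SortingNet C) (hllnf : LLNF C)
    (i i1 i2 : Fin n) (h1 : (i1 : ℕ) = (i : ℕ) + 1) (h2 : (i2 : ℕ) = (i : ℕ) + 2)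
    (hcomp : (i, i1) ∈ C.getD (d - 1) ∅)
    (hi2used : UsedIn i2 (C.getD (d - 2) ∅))
    (hi2unused : ¬ UsedIn i2 (C.getD (d - 1) ∅))
    (hi : ¬ UsedIn i (C.getD (d - 2) ∅)) (hi1 : ¬ UsedIn i1 (C.getD (d - 2) ∅)) :
    ∃ C' : List (Finset (Fin n × Fin n)),
      C'.length = d ∧ SortingNet C' ∧ LLNF C' ∧
      UsedIn i1 (C'.getD (d - 2) ∅) ∧ UsedIn i2 (C'.getD (d - 2) ∅) ∧
      UsedIn i1 (C'.getD (d - 1) ∅) ∧ UsedIn i2 (C'.getD (d - 1) ∅) := by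
  classical
  obtain ⟨P, A, B, rfl⟩ := aux_split C (by omega)
  have hdP : d = P.length + 2 := by simpa using hd.symm
  subst hdP
  have gA : ∀ A B : Finset (Fin n × Fin n), (P ++ [A, B]).getD (P.length + 2 - 2) ∅ = A := by
    intro A B; simp [List.getD]
  have gB : ∀ A B : Finset (Fin n × Fin n), (P ++ [A, B]).getD (P.length + 2 - 1) ∅ = B := by
    intro A B; simp [List.getD]
  have gB' : ∀ A B : Finset (Fin n × Fin n),
      (P ++ [A, B]).getD ((P ++ [A, B]).length - 1) ∅ = B := by
    intro A B; simp [List.getD]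
  rw [gA] at hi2used hi hi1
  rw [gB] at hcomp hi2unused
  unfold LLNF at hllnf
  rw [gB'] at hllnf
  obtain ⟨hval, hsort⟩ := hC
  have hA : ValidLayer A := hval A (by simp)
  have hB : ValidLayer B := hval B (by simp)
  have hii1 : i < i1 := by rw [Fin.lt_def]; omega
  have hi12 : i1 < i2 := by rw [Fin.lt_def]; omega
  let E : Finset (Fin n × Fin n) := {(i, i1)}
  let R := B.erase (i, i1)
  let X : Finset (Fin n × Fin n) := Finset.univ.filter
    (fun p => p = (i1, i2) ∨ (p.2 = i ∧ (p.2 : ℕ) = (p.1 : ℕ) + 1 ∧ ¬ UsedIn p.1 B))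
  have hX : ∀ p, p ∈ X ↔
      (p = (i1, i2) ∨ (p.2 = i ∧ (p.2 : ℕ) = (p.1 : ℕ) + 1 ∧ ¬ UsedIn p.1 B)) := by
    intro p; simp [X]
  have hE : ValidLayer E := by
    refine ⟨by simpa [E] using hii1, ?_⟩
    intro p hp q hq hpq
    simp only [E, Finset.mem_singleton] at hp hq
    exact absurd (hp.trans hq.symm) hpq
  have hR : ValidLayer R :=
    ⟨fun p hp => hB.1 p (Finset.mem_of_mem_erase hp), fun p hp q hq =>
      hB.2 p (Finset.mem_of_mem_erase hp) q (Finset.mem_of_mem_erase hq)⟩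
  have hXv : ValidLayer X := by
    refine ⟨?_, ?_⟩
    · intro p hp
      rcases (hX p).1 hp with rfl | ⟨_, h, _⟩
      · exact hi12
      · rw [Fin.lt_def]; omega
    · rintro ⟨a, b⟩ hp ⟨c, e⟩ hq hpq
      have hp' := (hX _).1 hp
      have hq' := (hX _).1 hq
      simp only [Prod.mk.injEq, Fin.ext_iff, ne_eq] at hp' hq' hpq ⊢
      omega
  have hXlt := hXv.1
  have RB : ∀ c, UsedIn c R → UsedIn c B := by
    rintro c ⟨q, hq, h⟩
    exact ⟨q, Finset.mem_of_mem_erase hq, h⟩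
  have hRi : ¬ UsedIn i R := by
    rintro ⟨q, hq, h⟩
    have := hB.2 q (Finset.mem_of_mem_erase hq) _ hcomp (Finset.ne_of_mem_erase hq)
    rcases h with h | h
    exacts [this.1 h, this.2.2.1 h]
  have hRi1 : ¬ UsedIn i1 R := by
    rintro ⟨q, hq, h⟩
    have := hB.2 q (Finset.mem_of_mem_erase hq) _ hcomp (Finset.ne_of_mem_erase hq)
    rcases h with h | h
    exacts [this.2.1 h, this.2.2.2 h]
  have hEu : ∀ c, UsedIn c E → c = i ∨ c = i1 := by
    rintro c ⟨q, hq, h⟩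
    simp only [E, Finset.mem_singleton] at hq
    subst hq
    rcases h with h | h
    exacts [Or.inl h.symm, Or.inr h.symm]
  have dEA : ∀ c, UsedIn c E → ¬ UsedIn c A := by
    intro c hc
    rcases hEu c hc with rfl | rfl
    exacts [hi, hi1]
  have dER : ∀ c, UsedIn c E → ¬ UsedIn c R := by
    intro c hc
    rcases hEu c hc with rfl | rfl
    exacts [hRi, hRi1]
  have dRE : ∀ c, UsedIn c R → ¬ UsedIn c E := fun c h h' => dER c h' h
  have dXR : ∀ c, UsedIn c X → ¬ UsedIn c R := by
    rintro c ⟨q, hq, h⟩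
    rcases (hX q).1 hq with rfl | ⟨ha, hb, hc⟩
    · rcases h with rfl | rfl
      · exact hRi1
      · exact fun h => hi2unused (RB _ h)
    · rcases h with rfl | rfl
      · exact fun h => hc (RB _ h)
      · rw [ha]; exact hRi
  have hBeq : B = E ∪ R := by
    ext p
    simp only [E, R, Finset.mem_union, Finset.mem_singleton, Finset.mem_erase]
    by_cases hp : p = (i, i1)
    · simp [hp, hcomp]
    · simp [hp]
  have hi1X : (i1, i2) ∈ R ∪ X := Finset.mem_union_right _ ((hX _).2 (Or.inl rfl))
  have BR : ∀ c, c ≠ i → UsedIn c B → UsedIn c (R ∪ X) := by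
    rintro c hc ⟨q, hq, h⟩
    by_cases hqe : q = (i, i1)
    · subst hqe
      rcases h with h | h
      · exact absurd h.symm hc
      · exact ⟨_, hi1X, Or.inl h⟩
    · exact ⟨q, Finset.mem_union_left _ (Finset.mem_erase.2 ⟨hqe, hq⟩), h⟩
  refine ⟨P ++ [A ∪ E, R ∪ X], by simp, ⟨?_, ?_⟩, ?_, ?_⟩
  · intro L hL
    simp only [List.mem_append, List.mem_cons, List.not_mem_nil, or_false] at hL
    rcases hL with hL | rfl | rfl
    · exact hval L (by simp [hL])
    · exact aux_valid_union _ _ hA hE dEA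
    · exact aux_valid_union _ _ hR hXv dXR
  · intro x
    have hs := hsort x
    have e1 : applyNet (P ++ [A, B]) x = applyLayer B (applyLayer A (applyNet P x)) := by
      simp [applyNet]
    have e2 : applyNet (P ++ [A ∪ E, R ∪ X]) x =
        applyLayer (R ∪ X) (applyLayer (A ∪ E) (applyNet P x)) := by
      simp [applyNet]
    have e3 : applyNet (P ++ [A ∪ E, R ∪ X]) x = applyNet (P ++ [A, B]) x := by
      rw [e2, aux_union _ _ _ dXR, aux_union _ _ _ dEA, ← aux_union E R _ dRE, ← hBeq, ← e1]
      exact aux_sorted X _ hXlt hs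
    rw [e3]
    exact hs
  · unfold LLNF
    rw [gB']
    refine ⟨?_, ?_⟩
    · intro p hp
      rcases Finset.mem_union.1 hp with hp | hp
      · exact hllnf.1 p (Finset.mem_of_mem_erase hp)
      · rcases (hX p).1 hp with rfl | ⟨_, h, _⟩
        · show (i2 : ℕ) = (i1 : ℕ) + 1
          omega
        · exact h
    · intro a b hab
      by_cases ha : a = i
      · right
        have : b = i1 := by apply Fin.ext; rw [hab, ha, h1]
        exact ⟨_, hi1X, Or.inl this.symm⟩
      · by_cases hb : b = i
        · by_cases hu : UsedIn a B
          · exact Or.inl (BR a ha hu)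
          · exact Or.inl ⟨(a, b), Finset.mem_union_right _ ((hX _).2 (Or.inr ⟨hb, hab, hu⟩)),
              Or.inl rfl⟩
        · exact (hllnf.2 a b hab).imp (BR a ha) (BR b hb)
  · rw [gA, gB]
    refine ⟨⟨(i, i1), by simp [E], Or.inr rfl⟩, ?_, ⟨_, hi1X, Or.inl rfl⟩, ⟨_, hi1X, Or.inr rfl⟩⟩
    obtain ⟨q, hq, h⟩ := hi2used
    exact ⟨q, Finset.mem_union_left _ hq, h⟩
end
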